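/- arXiv:0905.0599 — 4 statements merged into one kernel-verified Lean document; each statement's English description precedes it below -/
import Mathlib

section
/- Let d2, d3 be integers with 3 ≤ d2 ≤ d3 such that 3 does not divide d2 and d3 cannot be written as 3a + b·d2 with natural numbers a, b. Let F = (F₁,F₂,F₃) be a polynomial automorphism of ℂ³ with deg F₁ = 3, deg F₂ = d2, deg F₃ = d3. Then there is no polynomial g ∈ ℂ[x,y] such that deg(F₃ − g(F₁,F₂)) < d3. -/
open MvPolynomial

namespace Aux

abbrev P := MvPolynomial (Fin 3) ℂ

/-- weight of an exponent -/
def wt (d : ℕ) (s : Fin 2 →₀ ℕ) : ℕ := 3 * s 0 + d * s 1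

lemma weight_eq (d : ℕ) (s : Fin 2 →₀ ℕ) : Finsupp.weight ![3, d] s = wt d s := by
  rw [Finsupp.weight_apply, Finsupp.sum_fintype _ _ (by simp)]
  simp [wt, Fin.sum_univ_two, mul_comm]

lemma chain {σ : Type*} [Fintype σ] {A : Type*} [CommRing A] [Algebra ℂ A]
    (D : Derivation ℂ A A) (v : σ → A) (p : MvPolynomial σ ℂ) :
    D (aeval v p) = ∑ i, aeval v (pderiv i p) * D (v i) := by
  classical
  induction p using MvPolynomial.induction_on with
  | C a => simp
  | add p q hp hq => simp [hp, hq, add_mul, Finset.sum_add_distrib]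
  | mul_X p j hp =>
    simp only [map_mul, aeval_X, Derivation.leibniz, hp, smul_eq_mul, map_add, pderiv_X, add_mul,
      Finset.sum_add_distrib, Finset.mul_sum]
    congr 1
    · rw [Finset.sum_eq_single j]
      · simp
      · intro b _ hb
        simp [hb.symm]
      · simp
    · exact Finset.sum_congr rfl fun i _ => by ring

lemma totalDegree_pderiv (i : Fin 3) (p : P) (hp : pderiv i p ≠ 0) :
    (pderiv i p).totalDegree + 1 ≤ p.totalDegree := by
  obtain ⟨s, hs, hs'⟩ := Finset.exists_mem_eq_sup (pderiv i p).support (by simpa using hp)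
    (fun s => s.sum fun _ e => e)
  have hc : coeff (s + Finsupp.single i 1) p ≠ 0 := by
    intro h
    rw [mem_support_iff, coeff_pderiv, h] at hs
    simp at hs
  have := le_totalDegree (mem_support_iff.2 hc)
  rw [Finsupp.sum_add_index' (by simp) (by simp)] at this
  rw [totalDegree, hs']
  simpa using this

lemma hc_mul (m n : ℕ) (p q : P) (hp : p.totalDegree ≤ m) (hq : q.totalDegree ≤ n) :
    homogeneousComponent (m + n) (p * q) = homogeneousComponent m p * homogeneousComponent n q := by
  ext s
  rw [coeff_homogeneousComponent]
  split_ifs with h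
  · rw [coeff_mul, coeff_mul]
    refine Finset.sum_congr rfl fun x hx => ?_
    rw [coeff_homogeneousComponent, coeff_homogeneousComponent]
    have hx' := Finset.HasAntidiagonal.mem_antidiagonal.1 hx
    have hd : x.1.degree + x.2.degree = m + n := by
      rw [← h, ← hx', map_add]
    by_cases h1 : x.1.degree = m
    · have h2 : x.2.degree = n := by omega
      simp [h1, h2]
    · rw [if_neg h1, zero_mul]
      rcases Nat.lt_or_gt_of_ne h1 with h1 | h1
      · rw [coeff_eq_zero_of_totalDegree_lt (f := q), mul_zero]
        show _ < x.2.degree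
        omega
      · rw [coeff_eq_zero_of_totalDegree_lt (f := p), zero_mul]
        show _ < x.1.degree
        omega
  · by_contra hne
    have := ((homogeneousComponent_isHomogeneous m p).mul
      (homogeneousComponent_isHomogeneous n q)) (Ne.symm hne)
    exact h ((DFunLike.congr_fun (Finsupp.degree_eq_weight_one (R := ℕ)) s).trans this)

lemma hc_pow (m a : ℕ) (p : P) (hp : p.totalDegree ≤ m) :
    homogeneousComponent (a * m) (p ^ a) = homogeneousComponent m p ^ a := by
  induction a with
  | zero => simp
  | succ a ih =>
    rw [pow_succ, pow_succ, ← ih, Nat.succ_mul, hc_mul _ _ _ _ _ hp]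
    exact (totalDegree_pow _ _).trans (Nat.mul_le_mul_left _ hp)

lemma aeval_mon {A : Type*} [CommRing A] [Algebra ℂ A] (f h : A) (s : Fin 2 →₀ ℕ) (c : ℂ) :
    aeval ![f, h] (monomial s c) = c • (f ^ s 0 * h ^ s 1) := by
  rw [aeval_monomial, Finsupp.prod_fintype _ _ (by simp), Algebra.smul_def]
  simp [Fin.prod_univ_two]

lemma deg_mon (d : ℕ) (f h : P) (hf : f.totalDegree ≤ 3) (hh : h.totalDegree ≤ d)
    (s : Fin 2 →₀ ℕ) (c : ℂ) : (aeval ![f, h] (monomial s c)).totalDegree ≤ wt d s := by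
  rw [aeval_mon]
  refine (totalDegree_smul_le _ _).trans ((totalDegree_mul _ _).trans ?_)
  refine Nat.add_le_add ((totalDegree_pow _ _).trans ?_) ((totalDegree_pow _ _).trans ?_)
  · rw [mul_comm]; exact Nat.mul_le_mul_right _ hf
  · rw [mul_comm]; exact Nat.mul_le_mul_right _ hh

lemma top_mon (d n : ℕ) (f h : P) (hf : f.totalDegree ≤ 3) (hh : h.totalDegree ≤ d)
    (s : Fin 2 →₀ ℕ) (c : ℂ) (hs : wt d s ≤ n) :
    homogeneousComponent n (aeval ![f, h] (monomial s c)) =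
      aeval ![homogeneousComponent 3 f, homogeneousComponent d h]
        (weightedHomogeneousComponent ![3, d] n (monomial s c)) := by
  rcases hs.eq_or_lt with hs | hs
  · rw [weightedHomogeneousComponent_of_mem (m := n)
      (isWeightedHomogeneous_monomial _ _ _ (by rw [weight_eq, hs])), if_pos rfl, aeval_mon,
      aeval_mon, map_smul, ← hs, wt, mul_comm 3, mul_comm d, hc_mul, hc_pow _ _ _ hf,
      hc_pow _ _ _ hh]
    · exact (totalDegree_pow _ _).trans (Nat.mul_le_mul_left _ hf)
    · exact (totalDegree_pow _ _).trans (Nat.mul_le_mul_left _ hh)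
  · rw [weightedHomogeneousComponent_of_mem (m := n) (n := wt d s)
      (isWeightedHomogeneous_monomial _ _ _ (weight_eq d s)), if_neg (by omega), map_zero]
    exact homogeneousComponent_eq_zero _ _ ((deg_mon d f h hf hh s c).trans_lt hs)

lemma deg_le (d n : ℕ) (f h : P) (hf : f.totalDegree ≤ 3) (hh : h.totalDegree ≤ d)
    (g : MvPolynomial (Fin 2) ℂ) (hg : ∀ s ∈ g.support, wt d s ≤ n) :
    (aeval ![f, h] g).totalDegree ≤ n := by
  rw [g.as_sum, map_sum]
  exact totalDegree_finsetSum_le fun s hs => (deg_mon d f h hf hh s _).trans (hg s hs)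

lemma top (d n : ℕ) (f h : P) (hf : f.totalDegree ≤ 3) (hh : h.totalDegree ≤ d)
    (g : MvPolynomial (Fin 2) ℂ) (hg : ∀ s ∈ g.support, wt d s ≤ n) :
    homogeneousComponent n (aeval ![f, h] g) =
      aeval ![homogeneousComponent 3 f, homogeneousComponent d h]
        (weightedHomogeneousComponent ![3, d] n g) := by
  rw [g.as_sum, map_sum, map_sum, map_sum, map_sum]
  exact Finset.sum_congr rfl fun s hs => top_mon d n f h hf hh s _ (hg s hs)

lemma wt_add (d : ℕ) (s : Fin 2 →₀ ℕ) : wt d (s + Finsupp.single 1 1) = wt d s + d := by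
  simp [wt, mul_add, add_assoc]

lemma pderiv_whc (d n : ℕ) (g : MvPolynomial (Fin 2) ℂ) :
    pderiv 1 (weightedHomogeneousComponent ![3, d] (n + d) g) =
      weightedHomogeneousComponent ![3, d] n (pderiv 1 g) := by
  ext s
  rw [coeff_pderiv, coeff_weightedHomogeneousComponent, coeff_weightedHomogeneousComponent,
    coeff_pderiv, weight_eq, weight_eq, wt_add]
  by_cases h : wt d s = n <;> simp [h]

lemma pderiv_wt (d n : ℕ) (g : MvPolynomial (Fin 2) ℂ) (hg : ∀ s ∈ g.support, wt d s ≤ n + d) :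
    ∀ s ∈ (pderiv 1 g).support, wt d s ≤ n := by
  intro s hs
  rw [mem_support_iff, coeff_pderiv] at hs
  have := hg _ (mem_support_iff.2 (left_ne_zero_of_mul hs))
  rw [wt_add] at this
  omega

lemma iter (d n m : ℕ) (g : MvPolynomial (Fin 2) ℂ)
    (hg : ∀ s ∈ g.support, wt d s ≤ n + m * d) :
    (∀ s ∈ ((pderiv 1)^[m] g).support, wt d s ≤ n) ∧
    (pderiv 1)^[m] (weightedHomogeneousComponent ![3, d] (n + m * d) g) =
      weightedHomogeneousComponent ![3, d] n ((pderiv 1)^[m] g) := by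
  induction m generalizing g with
  | zero => simpa using hg
  | succ m ih =>
    rw [Nat.succ_mul, ← add_assoc] at hg ⊢
    rw [Function.iterate_succ_apply, Function.iterate_succ_apply, pderiv_whc]
    exact ih _ (pderiv_wt _ _ _ hg)

lemma iter_poly (f : P) (m : ℕ) (g : MvPolynomial (Fin 2) ℂ) :
    Polynomial.derivative^[m] (aeval ![Polynomial.C f, Polynomial.X] g) =
      aeval ![Polynomial.C f, Polynomial.X] ((pderiv 1)^[m] g) := by
  induction m generalizing g with
  | zero => rfl
  | succ m ih =>
    rw [Function.iterate_succ_apply, Function.iterate_succ_apply, ← ih]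
    congr 1
    have := chain ((Polynomial.derivative' (R := P)).restrictScalars ℂ)
      ![Polynomial.C f, Polynomial.X] g
    simpa [Fin.sum_univ_two] using this

lemma eval_poly (f h : P) (g : MvPolynomial (Fin 2) ℂ) :
    (aeval ![Polynomial.C f, Polynomial.X] g : Polynomial P).eval h = aeval ![f, h] g := by
  induction g using MvPolynomial.induction_on with
  | C a => simp [Polynomial.algebraMap_apply]
  | add p q hp hq => simp [hp, hq]
  | mul_X p j hp =>
    rw [map_mul, map_mul, Polynomial.eval_mul, hp]
    fin_cases j <;> simp

/-- one step of the bracket estimate -/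
lemma step (f h : P) (hf : f.totalDegree ≤ 3) (i j : Fin 3)
    (hJ : pderiv i f * pderiv j h - pderiv j f * pderiv i h ≠ 0)
    (g : MvPolynomial (Fin 2) ℂ) :
    (aeval ![f, h] (pderiv 1 g)).totalDegree ≤ (aeval ![f, h] g).totalDegree + 1 := by
  by_cases h0 : aeval ![f, h] (pderiv 1 g) = 0
  · rw [h0, totalDegree_zero]; omega
  set G := aeval ![f, h] g with hG
  have key : aeval ![f, h] (pderiv 1 g) * (pderiv i f * pderiv j h - pderiv j f * pderiv i h) =
      pderiv i f * pderiv j G - pderiv j f * pderiv i G := by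
    rw [hG, chain (pderiv i), chain (pderiv j)]
    simp [Fin.sum_univ_two]
    ring
  have h1 : (aeval ![f, h] (pderiv 1 g)).totalDegree ≤
      (pderiv i f * pderiv j G - pderiv j f * pderiv i G).totalDegree := by
    rw [← key, totalDegree_mul_of_isDomain h0 hJ]
    omega
  refine h1.trans ((totalDegree_sub _ _).trans ?_)
  have aux : ∀ i j : Fin 3, (pderiv i f * pderiv j G).totalDegree ≤ G.totalDegree + 1 := by
    intro i j
    by_cases h1 : pderiv i f = 0
    · simp [h1]
    by_cases h2 : pderiv j G = 0
    · simp [h2]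
    have := totalDegree_pderiv i f h1
    have := totalDegree_pderiv j G h2
    refine (totalDegree_mul _ _).trans ?_
    omega
  exact max_le (aux _ _) (aux _ _)

lemma steps (f h : P) (hf : f.totalDegree ≤ 3) (i j : Fin 3)
    (hJ : pderiv i f * pderiv j h - pderiv j f * pderiv i h ≠ 0) (m : ℕ)
    (g : MvPolynomial (Fin 2) ℂ) :
    (aeval ![f, h] ((pderiv 1)^[m] g)).totalDegree ≤ (aeval ![f, h] g).totalDegree + m := by
  induction m generalizing g with
  | zero => simp
  | succ m ih =>
    rw [Function.iterate_succ_apply]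
    have := ih (pderiv 1 g)
    have := step f h hf i j hJ g
    omega

lemma jac (F : P ≃ₐ[ℂ] P) : ∃ i j : Fin 3,
    pderiv i (F (X 0)) * pderiv j (F (X 1)) - pderiv j (F (X 0)) * pderiv i (F (X 1)) ≠ 0 := by
  by_contra! hall
  let A : Matrix (Fin 3) (Fin 3) P := fun k i => pderiv i (F (X k))
  let M : Matrix (Fin 3) (Fin 3) P := fun j k => F (pderiv k (F.symm (X j)))
  have hF : ∀ p, F p = aeval (fun k => F (X k)) p := by
    intro p
    have : (F : P →ₐ[ℂ] P) = aeval (fun k => F (X k)) := by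
      ext k; simp
    exact DFunLike.congr_fun this p
  have hMA : M * A = 1 := by
    ext1 j i
    have h1 : pderiv i (X j : P) = ∑ k, M j k * A k i := by
      conv_lhs => rw [← F.apply_symm_apply (X j), hF, chain (pderiv i)]
      refine Finset.sum_congr rfl fun k _ => ?_
      rw [← hF]
    rw [Matrix.mul_apply, ← h1, pderiv_X, Matrix.one_apply, Pi.single_apply]
  have hdet : A.det = 0 := by
    rw [Matrix.det_fin_three]
    have a := hall 0 1
    have b := hall 0 2
    have c := hall 1 2
    simp only [A]
    linear_combination (pderiv 2 (F (X 2))) * a - (pderiv 1 (F (X 2))) * b + (pderiv 0 (F (X 2))) * c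
  have := congrArg Matrix.det hMA
  rw [Matrix.det_mul, hdet, mul_zero, Matrix.det_one] at this
  exact zero_ne_one this

lemma poly_coeff (f : P) (g : MvPolynomial (Fin 2) ℂ) (b : ℕ) :
    (aeval ![Polynomial.C f, Polynomial.X] g : Polynomial P).coeff b =
      ∑ s ∈ g.support, if s 1 = b then coeff s g • f ^ s 0 else 0 := by
  conv_lhs => rw [g.as_sum]
  rw [map_sum, Polynomial.finsetSum_coeff]
  refine Finset.sum_congr rfl fun s _ => ?_
  rw [aeval_mon, Polynomial.coeff_smul, ← Polynomial.C_pow, Polynomial.coeff_C_mul,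
    Polynomial.coeff_X_pow]
  by_cases h : s 1 = b
  · simp [h]
  · simp [h, Ne.symm h]

lemma mult3 (h : P) (hh : h ≠ 0) (Q : Polynomial P) (hQ : Q ≠ 0) (b : ℕ)
    (hb : ∀ i, Q.coeff i ≠ 0 → i % 3 = b % 3) :
    3 * Q.rootMultiplicity h ≤ Q.natDegree := by
  classical
  obtain ⟨w, hw⟩ : ∃ w : ℂ, IsPrimitiveRoot w 3 := ⟨_, Complex.isPrimitiveRoot_exp 3 (by norm_num)⟩
  have hw3 := hw.pow_eq_one
  have hw0 : w ≠ 0 := hw.ne_zero (by norm_num)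
  set m := Q.rootMultiplicity h
  have hsym : ∀ u : ℂ, u ^ 3 = 1 →
      Q.comp (Polynomial.C (C u : P) * Polynomial.X) = Polynomial.C (C (u ^ b)) * Q := by
    intro u hu
    ext1 i
    rw [Polynomial.comp_C_mul_X_coeff, Polynomial.coeff_C_mul]
    by_cases hi : Q.coeff i = 0
    · simp [hi]
    · have h3 : u ^ i = u ^ b := by
        rw [pow_eq_pow_mod i hu, pow_eq_pow_mod b hu, hb i hi]
      rw [← map_pow, h3, mul_comm]
  have hrot : ∀ u : ℂ, u ^ 3 = 1 → m ≤ Q.rootMultiplicity (C u * h) := by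
    intro u hu
    have hu0 : u ≠ 0 := by rintro rfl; norm_num at hu
    rw [Polynomial.le_rootMultiplicity_iff hQ]
    obtain ⟨R, hR⟩ := Q.pow_rootMultiplicity_dvd h
    have hu' : (u⁻¹) ^ 3 = 1 := by rw [inv_pow, hu, inv_one]
    have h1 := hsym u⁻¹ hu'
    rw [hR, Polynomial.mul_comp, ← hR, Polynomial.pow_comp] at h1
    have h2 : (Polynomial.X - Polynomial.C h).comp (Polynomial.C (C u⁻¹ : P) * Polynomial.X) =
        Polynomial.C (C u⁻¹) * (Polynomial.X - Polynomial.C (C u * h)) := by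
      have : (C u⁻¹ : P) * (C u * h) = h := by
        rw [← mul_assoc, ← C_mul, inv_mul_cancel₀ hu0, C_1, one_mul]
      simp only [Polynomial.sub_comp, Polynomial.X_comp, Polynomial.C_comp, mul_sub,
        ← Polynomial.C_mul, this]
    rw [h2, mul_pow] at h1
    have h3 : (Polynomial.X - Polynomial.C (C u * h)) ^ m ∣ Polynomial.C (C (u⁻¹ ^ b)) * Q :=
      ⟨_, by rw [← h1, mul_comm (_ ^ _) (_ ^ _), mul_assoc]⟩
    have h4 : IsUnit (Polynomial.C (C (u⁻¹ ^ b) : P)) :=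
      Polynomial.isUnit_C.2 ((IsUnit.mk0 _ (pow_ne_zero _ (inv_ne_zero hu0))).map C)
    exact (h4.dvd_mul_left).1 h3
  have hinj : ∀ u v : ℂ, u ≠ v → (C u * h : P) ≠ C v * h := by
    intro u v huv he
    exact huv (C_injective _ _ (mul_right_cancel₀ hh he))
  have h01 : (1 : ℂ) ≠ w := fun he => by
    have := hw.pow_ne_one_of_pos_of_lt (l := 1) (by norm_num) (by norm_num)
    simp [← he] at this
  have h02 : (1 : ℂ) ≠ w ^ 2 := fun he =>
    hw.pow_ne_one_of_pos_of_lt (l := 2) (by norm_num) (by norm_num) he.symm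
  have h12 : w ≠ w ^ 2 := fun he => h01 (mul_left_cancel₀ hw0 (by linear_combination he))
  have hle : m • (({C 1 * h, C w * h, C (w ^ 2) * h} : Finset P).val) ≤ Q.roots := by
    rw [Multiset.le_iff_count]
    intro a
    rw [Multiset.count_nsmul]
    by_cases ha : a ∈ ({C 1 * h, C w * h, C (w ^ 2) * h} : Finset P)
    · rw [Multiset.count_eq_one_of_mem (Finset.nodup _) ha, mul_one, Polynomial.count_roots]
      simp only [Finset.mem_insert, Finset.mem_singleton] at ha
      rcases ha with rfl | rfl | rfl
      · exact hrot 1 (by simp)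
      · exact hrot w hw3
      · exact hrot (w ^ 2) (by rw [← pow_mul, mul_comm, pow_mul, hw3, one_pow])
    · rw [Multiset.count_eq_zero_of_notMem ha]
      simp
  have hcard := (Multiset.card_le_card hle).trans (Polynomial.card_roots' Q)
  rw [Multiset.card_nsmul, Finset.card_val, Finset.card_eq_three.2
    ⟨_, _, _, hinj _ _ h01, hinj _ _ h02, hinj _ _ h12, rfl⟩] at hcard
  simpa [mul_comm] using hcard

lemma hc_ne (p : P) (n : ℕ) (hn : n ≠ 0) (hp : p.totalDegree = n) :
    homogeneousComponent n p ≠ 0 := by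
  intro h0
  have hp0 : p ≠ 0 := by rintro rfl; simp at hp; omega
  obtain ⟨s, hs, hs'⟩ := Finset.exists_mem_eq_sup p.support (by simpa using hp0)
    (fun s => s.sum fun _ e => e)
  have h1 := congrArg (coeff s) h0
  rw [coeff_homogeneousComponent, if_pos, coeff_zero] at h1
  · exact mem_support_iff.1 hs h1
  · rw [← hp, totalDegree, hs']; rfl

lemma main (d : ℕ) (hd : 0 < d) (hdvd : ¬ 3 ∣ d) (f h : P) (hf : f.totalDegree = 3)
    (hh : h.totalDegree = d) (i j : Fin 3)
    (hJ : pderiv i f * pderiv j h - pderiv j f * pderiv i h ≠ 0)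
    (g : MvPolynomial (Fin 2) ℂ) (hg : g ≠ 0) :
    (∃ a b : ℕ, (aeval ![f, h] g).totalDegree = 3 * a + b * d) ∨
      2 * d ≤ (aeval ![f, h] g).totalDegree + 1 := by
  classical
  obtain ⟨s, hs, hs'⟩ := Finset.exists_mem_eq_sup g.support (by simpa using hg) (wt d)
  set N := wt d s with hN
  have hwt : ∀ t ∈ g.support, wt d t ≤ N := fun t ht => hs' ▸ Finset.le_sup (f := wt d) ht
  set f' := homogeneousComponent 3 f
  set h' := homogeneousComponent d h
  have hf' : f' ≠ 0 := hc_ne f 3 (by norm_num) hf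
  have hh' : h' ≠ 0 := hc_ne h d hd.ne' hh
  set gt := weightedHomogeneousComponent ![3, d] N g with hgt
  have hgts : ∀ t ∈ gt.support, wt d t = N := by
    intro t ht
    rw [mem_support_iff, hgt, coeff_weightedHomogeneousComponent, weight_eq] at ht
    by_contra hne
    simp [hne] at ht
  have hsgt : s ∈ gt.support := by
    rw [mem_support_iff, hgt, coeff_weightedHomogeneousComponent, weight_eq, if_pos rfl]
    exact mem_support_iff.1 hs
  set Q : Polynomial P := aeval ![Polynomial.C f', Polynomial.X] gt with hQdef
  have hQc : ∀ b, Q.coeff b ≠ 0 → ∃ t ∈ gt.support, t 1 = b := by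
    intro b hb
    rw [hQdef, poly_coeff] at hb
    obtain ⟨t, ht, ht'⟩ := Finset.exists_ne_zero_of_sum_ne_zero hb
    exact ⟨t, ht, by by_contra hne; simp [hne] at ht'⟩
  have hQ0 : Q ≠ 0 := by
    intro h0
    have h1 := congrArg (fun q => Polynomial.coeff q (s 1)) h0
    simp only [Polynomial.coeff_zero] at h1
    rw [hQdef, poly_coeff, Finset.sum_eq_single s, if_pos rfl] at h1
    · rcases smul_eq_zero.1 h1 with h1 | h1
      · exact mem_support_iff.1 hsgt h1
      · exact pow_ne_zero _ hf' h1
    · intro t ht hts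
      rw [if_neg]
      intro h2
      apply hts
      have h3 := hgts t ht
      rw [hN, wt, wt, h2] at h3
      ext k
      fin_cases k
      · show t 0 = s 0
        omega
      · exact h2
    · exact fun hn => (hn hsgt).elim
  have hmod : ∀ k, Q.coeff k ≠ 0 → k % 3 = s 1 % 3 := by
    intro k hk
    obtain ⟨t, ht, rfl⟩ := hQc k hk
    have h3 := hgts t ht
    rw [hN, wt, wt] at h3
    have h4 : (d * t 1) % 3 = (d * s 1) % 3 := by omega
    have h5 : Nat.Coprime 3 d := (Nat.Prime.coprime_iff_not_dvd Nat.prime_three).2 hdvd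
    exact Nat.ModEq.cancel_left_of_coprime h5 h4
  have h3m := mult3 h' hh' Q hQ0 (s 1) hmod
  set m := Q.rootMultiplicity h' with hm
  have hdeg : Q.natDegree * d ≤ N := by
    obtain ⟨t, ht, ht'⟩ := hQc Q.natDegree (by simpa using hQ0)
    rw [← hgts t ht, ← ht', wt, mul_comm]
    omega
  have h3md : 3 * m * d ≤ N := (Nat.mul_le_mul_right _ h3m).trans hdeg
  obtain ⟨n, hn⟩ : ∃ n, N = n + m * d := ⟨N - m * d, by
    have : m * d ≤ 3 * m * d := by nlinarith
    omega⟩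
  have hne : (Polynomial.derivative^[m] Q).eval h' ≠ 0 := by
    intro h0
    have : m < Q.rootMultiplicity h' := by
      rw [Polynomial.lt_rootMultiplicity_iff_isRoot_iterate_derivative hQ0]
      intro k hk
      rcases hk.eq_or_lt with rfl | hk
      · exact h0
      · exact Polynomial.isRoot_iterate_derivative_of_lt_rootMultiplicity hk
    omega
  obtain ⟨hw, hT⟩ := iter d n m g (hn ▸ hwt)
  rw [← hn, ← hgt] at hT
  rw [hQdef, iter_poly, eval_poly, hT, ← top d n f h hf.le hh.le _ hw] at hne
  have hlow : n ≤ (aeval ![f, h] ((pderiv 1)^[m] g)).totalDegree := by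
    by_contra! hlt
    exact hne (homogeneousComponent_eq_zero _ _ hlt)
  have hst := steps f h hf.le i j hJ m g
  have hup := deg_le d N f h hf.le hh.le g hwt
  rcases Nat.eq_zero_or_pos m with h0 | h0
  · left
    refine ⟨s 0, s 1, ?_⟩
    rw [h0] at hn hst
    have : (aeval ![f, h] g).totalDegree = N := by rw [h0] at hlow; omega
    rw [this, hN, wt, mul_comm d]
  · right
    have h6 : 2 * m * d ≤ (aeval ![f, h] g).totalDegree + m := by
      have : 3 * m * d = 2 * m * d + m * d := by ring
      omega
    clear_value m
    obtain ⟨k, rfl⟩ : ∃ k, m = k + 1 := ⟨m - 1, by omega⟩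
    have : k ≤ k * d := Nat.le_mul_of_pos_right _ hd
    have : 2 * (k + 1) * d = 2 * (k * d) + 2 * d := by ring
    omega

lemma frob (d e : ℕ) (hd : ¬ 3 ∣ d) (h : 2 * d ≤ e + 1) : ∃ a b : ℕ, e = 3 * a + b * d := by
  have hd1 : d % 3 = 1 ∨ d % 3 = 2 := by omega
  have he : e % 3 = 0 ∨ e % 3 = 1 ∨ e % 3 = 2 := by omega
  rcases hd1 with hd1 | hd1 <;> rcases he with he | he | he
  · exact ⟨e / 3, 0, by omega⟩
  · exact ⟨(e - d) / 3, 1, by omega⟩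
  · exact ⟨(e - 2 * d) / 3, 2, by omega⟩
  · exact ⟨e / 3, 0, by omega⟩
  · exact ⟨(e - 2 * d) / 3, 2, by omega⟩
  · exact ⟨(e - d) / 3, 1, by omega⟩

end Aux

/-- Suppose `3 ≤ d2 ≤ d3`, `3 ∤ d2` and `d3 ∉ 3ℕ + d2ℕ`. If `F = (F₁, F₂, F₃)` is a polynomial
automorphism of `ℂ³` with `mdeg F = (3, d2, d3)`, then no polynomial `g ∈ ℂ[x,y]` satisfies
`deg (F₃ - g(F₁, F₂)) < d3`. -/
theorem no_elementary_reduction_third (d2 d3 : ℕ) (h2 : 3 ≤ d2) (h23 : d2 ≤ d3)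
    (hdvd : ¬ 3 ∣ d2) (hmem : ¬ ∃ a b : ℕ, d3 = 3 * a + b * d2)
    (F : MvPolynomial (Fin 3) ℂ ≃ₐ[ℂ] MvPolynomial (Fin 3) ℂ)
    (hF1 : (F (X 0)).totalDegree = 3) (hF2 : (F (X 1)).totalDegree = d2)
    (hF3 : (F (X 2)).totalDegree = d3) :
    ¬ ∃ g : MvPolynomial (Fin 2) ℂ,
      (F (X 2) - aeval ![F (X 0), F (X 1)] g).totalDegree < d3 := by
  rintro ⟨g, hg⟩
  have hG : (aeval ![F (X 0), F (X 1)] g).totalDegree = d3 := by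
    have h1 : aeval ![F (X 0), F (X 1)] g =
        -(F (X 2) - aeval ![F (X 0), F (X 1)] g) + F (X 2) := by ring
    rw [h1, totalDegree_add_eq_right_of_totalDegree_lt, hF3]
    rw [totalDegree_neg, hF3]
    exact hg
  have hg0 : g ≠ 0 := by
    rintro rfl
    simp at hG
    omega
  obtain ⟨i, j, hJ⟩ := Aux.jac F
  rcases Aux.main d2 (by omega) hdvd _ _ hF1 hF2 i j hJ g hg0 with h | h
  · rw [hG] at h
    exact hmem h
  · rw [hG] at h
    exact hmem (Aux.frob d2 d3 hdvd h)
end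

section
/- Let d2, d3 be integers with 3 ≤ d2 ≤ d3 such that 3 does not divide d2 and d3 cannot be written as 3a + b·d2 with natural numbers a, b. Let F = (F₁,F₂,F₃) be a polynomial automorphism of ℂ³ with deg F₁ = 3, deg F₂ = d2, deg F₃ = d3. Then there is no polynomial g ∈ ℂ[x,y] such that deg(F₂ − g(F₁,F₃)) < d2. -/
open MvPolynomial

namespace NoElem

abbrev R3 := MvPolynomial (Fin 3) ℂ
abbrev R2 := MvPolynomial (Fin 2) ℂ

lemma hc_mul {f g : R3} {a b : ℕ} (hf : f.totalDegree ≤ a) (hg : g.totalDegree ≤ b) :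
    homogeneousComponent (a + b) (f * g) = homogeneousComponent a f * homogeneousComponent b g := by
  classical
  ext d
  rw [coeff_homogeneousComponent, coeff_mul, coeff_mul]
  simp only [coeff_homogeneousComponent]
  have key : ∀ x ∈ Finset.HasAntidiagonal.antidiagonal d, x.1.degree + x.2.degree = d.degree := by
    intro x hx
    rw [Finset.HasAntidiagonal.mem_antidiagonal] at hx
    rw [← hx, map_add]
  have hz : ∀ (p : R3) (n : ℕ) (x : Fin 3 →₀ ℕ), p.totalDegree ≤ n → n < x.degree →
      coeff x p = 0 := by
    intro p n x hp hx
    apply coeff_eq_zero_of_totalDegree_lt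
    rw [← Finsupp.degree_apply]
    omega
  split_ifs with h
  · apply Finset.sum_congr rfl
    intro x hx
    have := key x hx
    by_cases h1 : x.1.degree = a
    · have h2 : x.2.degree = b := by omega
      simp [h1, h2]
    · rw [if_neg h1, zero_mul]
      rcases lt_or_gt_of_ne h1 with h1 | h1
      · rw [hz g b x.2 hg (by omega), mul_zero]
      · rw [hz f a x.1 hf h1, zero_mul]
  · symm
    apply Finset.sum_eq_zero
    intro x hx
    have := key x hx
    split_ifs <;> first | (exfalso; omega) | simp

lemma hc_pow {f : R3} {a : ℕ} (hf : f.totalDegree ≤ a) (n : ℕ) :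
    homogeneousComponent (n * a) (f ^ n) = homogeneousComponent a f ^ n := by
  induction n with
  | zero => simp [homogeneousComponent_zero]
  | succ n ih =>
    rw [pow_succ, pow_succ, ← ih, Nat.succ_mul, hc_mul _ hf]
    exact (totalDegree_pow _ _).trans (Nat.mul_le_mul_left _ hf)

lemma weight_two (a b : ℕ) (s : Fin 2 →₀ ℕ) :
    Finsupp.weight ![a, b] s = s 0 * a + s 1 * b := by
  rw [Finsupp.weight_apply, Finsupp.sum_fintype _ _ (by simp)]
  simp [Fin.sum_univ_two]

lemma aeval_monomial_two {A : Type*} [CommRing A] [Algebra ℂ A] (u v : A) (s : Fin 2 →₀ ℕ) (c : ℂ) :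
    aeval ![u, v] (monomial s c : R2) = c • (u ^ s 0 * v ^ s 1) := by
  rw [aeval_monomial, Finsupp.prod_fintype _ _ (by simp)]
  simp [Fin.prod_univ_two, Algebra.smul_def]

lemma totalDegree_aeval_monomial (f h : R3) (s : Fin 2 →₀ ℕ) (c : ℂ) :
    (aeval ![f, h] (monomial s c : R2)).totalDegree ≤ s 0 * f.totalDegree + s 1 * h.totalDegree := by
  rw [aeval_monomial_two]
  refine (totalDegree_smul_le _ _).trans ((totalDegree_mul _ _).trans ?_)
  exact add_le_add (totalDegree_pow _ _) (totalDegree_pow _ _)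

/-- weighted degree at most `D` -/
def WLe (a b : ℕ) (G : R2) (D : ℕ) : Prop := ∀ s ∈ G.support, s 0 * a + s 1 * b ≤ D

lemma totalDegree_aeval_le {f h : R3} {G : R2} {D : ℕ}
    (hG : WLe f.totalDegree h.totalDegree G D) : (aeval ![f, h] G).totalDegree ≤ D := by
  conv_lhs => rw [G.as_sum, map_sum]
  refine totalDegree_finsetSum_le ?_
  intro s hs
  exact (totalDegree_aeval_monomial f h s _).trans (hG s hs)

lemma hc_aeval {f h : R3} {G : R2} {D : ℕ} (hG : WLe f.totalDegree h.totalDegree G D) :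
    homogeneousComponent D (aeval ![f, h] G) =
      aeval ![homogeneousComponent f.totalDegree f, homogeneousComponent h.totalDegree h]
        (weightedHomogeneousComponent ![f.totalDegree, h.totalDegree] D G) := by
  classical
  conv_lhs => rw [G.as_sum]
  rw [weightedHomogeneousComponent_apply, map_sum, map_sum, map_sum, Finset.sum_filter]
  apply Finset.sum_congr rfl
  intro s hs
  have h1 := hG s hs
  rw [weight_two]
  split_ifs with h2
  · rw [aeval_monomial_two, aeval_monomial_two, map_smul, ← h2, hc_mul (totalDegree_pow _ _)
      (totalDegree_pow _ _), hc_pow le_rfl, hc_pow le_rfl]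
  · apply homogeneousComponent_eq_zero
    exact lt_of_le_of_lt (totalDegree_aeval_monomial f h s _) (by omega)

lemma WLe_pderiv {a b : ℕ} {G : R2} {D : ℕ} (hG : WLe a b G (D + b)) :
    WLe a b (pderiv 1 G) D := by
  intro s hs
  rw [mem_support_iff, coeff_pderiv] at hs
  have := hG (s + Finsupp.single 1 1) (by rw [mem_support_iff]; exact left_ne_zero_of_mul hs)
  simp at this
  linarith

lemma whc_pderiv {a b : ℕ} (G : R2) (D : ℕ) :
    weightedHomogeneousComponent ![a, b] D (pderiv 1 G) =
      pderiv 1 (weightedHomogeneousComponent ![a, b] (D + b) G) := by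
  classical
  ext s
  simp only [coeff_weightedHomogeneousComponent, coeff_pderiv, weight_two]
  have : (s + Finsupp.single 1 1 : Fin 2 →₀ ℕ) 0 * a + (s + Finsupp.single 1 1 : Fin 2 →₀ ℕ) 1 * b
    = s 0 * a + s 1 * b + b := by simp; ring
  rw [this]
  split_ifs <;> first | (exfalso; omega) | simp

lemma WLe_pderiv_iter {a b : ℕ} (m : ℕ) : ∀ {G : R2} {D : ℕ}, WLe a b G (D + m * b) →
    WLe a b ((pderiv 1)^[m] G) D := by
  induction m with
  | zero => intro G D h; simpa using h
  | succ m ih =>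
    intro G D h
    rw [Function.iterate_succ_apply]
    exact ih (WLe_pderiv (by convert h using 1; ring))

lemma whc_pderiv_iter {a b : ℕ} (m : ℕ) : ∀ (G : R2) (D : ℕ),
    weightedHomogeneousComponent ![a, b] D ((pderiv 1)^[m] G) =
      (pderiv 1)^[m] (weightedHomogeneousComponent ![a, b] (D + m * b) G) := by
  induction m with
  | zero => intro G D; simp
  | succ m ih =>
    intro G D
    rw [Function.iterate_succ_apply, Function.iterate_succ_apply, ih, whc_pderiv]
    congr 3; ring_nf

/-- chain rule for derivations killing the first argument -/
lemma derivation_aeval (Δ : Derivation ℂ R3 R3) (f h : R3) (hf : Δ f = 0) (G : R2) :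
    Δ (aeval ![f, h] G) = aeval ![f, h] (pderiv 1 G) * Δ h := by
  induction G using MvPolynomial.induction_on with
  | C c => simp [algebraMap_eq]
  | add p q hp hq => rw [map_add, map_add, map_add, map_add, hp, hq, add_mul]
  | mul_X p i hp =>
    rw [map_mul, Derivation.leibniz, hp, Derivation.leibniz]
    fin_cases i
    · simp [hf, pderiv_X]; ring
    · simp [pderiv_X]; ring

lemma pderiv_degree (i : Fin 3) (p : R3) :
    pderiv i p = 0 ∨ (pderiv i p).totalDegree + 1 ≤ p.totalDegree := by
  by_cases h0 : pderiv i p = 0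
  · exact Or.inl h0
  right
  have : ∀ s ∈ (pderiv i p).support, s.degree + 1 ≤ p.totalDegree := by
    intro s hs
    rw [mem_support_iff, coeff_pderiv] at hs
    have h1 := le_totalDegree (p := p) (s := s + Finsupp.single i 1)
      (by rw [mem_support_iff]; exact left_ne_zero_of_mul hs)
    change (s + Finsupp.single i 1).degree ≤ _ at h1
    rw [map_add] at h1
    simpa using h1
  obtain ⟨s, hs⟩ := support_nonempty.mpr h0
  have hp := this s hs
  have : (pderiv i p).totalDegree ≤ p.totalDegree - 1 := by
    rw [totalDegree]
    refine Finset.sup_le ?_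
    intro s hs
    have := this s hs
    change s.degree ≤ _
    omega
  omega

lemma pderiv_mul_degree (i j : Fin 3) (f u : R3) (hf : f.totalDegree = 3) :
    (pderiv i f * pderiv j u).totalDegree ≤ u.totalDegree + 1 := by
  rcases pderiv_degree i f with h | h
  · simp [h]
  rcases pderiv_degree j u with h' | h'
  · simp [h']
  refine (totalDegree_mul _ _).trans ?_
  omega

lemma derivation_eq_sum (δ : Derivation ℂ R3 R3) (u : R3) :
    δ u = ∑ i, δ (X i) * pderiv i u := by
  have : δ = δ (X 0) • pderiv 0 + δ (X 1) • pderiv 1 + δ (X 2) • pderiv 2 := by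
    apply derivation_ext
    intro i
    fin_cases i <;> simp [pderiv_X]
  conv_lhs => rw [this]
  simp [Fin.sum_univ_three]

noncomputable def pull (F : R3 ≃ₐ[ℂ] R3) (k : Fin 3) : Derivation ℂ R3 R3 :=
  Derivation.mk' (F.toLinearMap ∘ₗ (pderiv k : Derivation ℂ R3 R3).toLinearMap ∘ₗ F.symm.toLinearMap)
    (by intro a b; simp [Derivation.leibniz])

lemma pull_apply (F : R3 ≃ₐ[ℂ] R3) (k : Fin 3) (u : R3) :
    pull F k (F u) = F (pderiv k u) := by
  change F (pderiv k (F.symm (F u))) = _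
  rw [AlgEquiv.symm_apply_apply]

lemma exists_derivation (F : R3 ≃ₐ[ℂ] R3) (hF1 : (F (X 0)).totalDegree = 3) :
    ∃ Δ : Derivation ℂ R3 R3, Δ (F (X 0)) = 0 ∧ Δ (F (X 2)) ≠ 0 ∧
      ∀ u, (Δ u).totalDegree ≤ u.totalDegree + 1 := by
  set f := F (X 0) with hf
  set h := F (X 2) with hh
  have key : ∃ i j, pderiv i f * pderiv j h - pderiv j f * pderiv i h ≠ 0 := by
    by_contra! hc
    have a1 : pull F 0 f = 1 := by rw [hf, pull_apply]; simp
    have a2 : pull F 2 f = 0 := by rw [hf, pull_apply]; simp [pderiv_X]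
    have a3 : pull F 0 h = 0 := by rw [hh, pull_apply]; simp [pderiv_X]
    have a4 : pull F 2 h = 1 := by rw [hh, pull_apply]; simp
    have e : pull F 0 f * pull F 2 h - pull F 2 f * pull F 0 h = 1 := by simp [a1, a2, a3, a4]
    rw [derivation_eq_sum (pull F 0) f, derivation_eq_sum (pull F 2) f,
      derivation_eq_sum (pull F 0) h, derivation_eq_sum (pull F 2) h] at e
    simp only [Fin.sum_univ_three] at e
    have h01 := hc 0 1
    have h02 := hc 0 2
    have h12 := hc 1 2
    refine one_ne_zero (α := R3) ?_
    rw [← e]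
    generalize pull F 0 (X 0) = p0
    generalize pull F 0 (X 1) = p1
    generalize pull F 0 (X 2) = p2
    generalize pull F 2 (X 0) = q0
    generalize pull F 2 (X 1) = q1
    generalize pull F 2 (X 2) = q2
    linear_combination (p0 * q1 - p1 * q0) * h01 + (p0 * q2 - p2 * q0) * h02
      + (p1 * q2 - p2 * q1) * h12
  obtain ⟨i, j, hij⟩ := key
  refine ⟨pderiv i f • pderiv j - pderiv j f • pderiv i, ?_, ?_, ?_⟩
  · simp; ring
  · simpa using hij
  · intro u
    simp only [Derivation.sub_apply, Derivation.smul_apply, smul_eq_mul]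
    refine (totalDegree_sub _ _).trans (max_le ?_ ?_)
    · exact pderiv_mul_degree _ _ _ _ hF1
    · exact pderiv_mul_degree _ _ _ _ hF1

lemma iter_bound (Δ : Derivation ℂ R3 R3) (f h : R3) (hf : Δ f = 0) (hh : Δ h ≠ 0)
    (hΔ : ∀ u, (Δ u).totalDegree ≤ u.totalDegree + 1) (m : ℕ) (G : R2) :
    (aeval ![f, h] ((pderiv 1)^[m] G)).totalDegree ≤ (aeval ![f, h] G).totalDegree + m := by
  induction m with
  | zero => simp
  | succ m ih =>
    rw [Function.iterate_succ_apply']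
    by_cases h0 : aeval ![f, h] (pderiv 1 ((pderiv 1)^[m] G)) = 0
    · rw [h0, totalDegree_zero]; exact Nat.zero_le _
    have h1 := hΔ (aeval ![f, h] ((pderiv 1)^[m] G))
    rw [derivation_aeval Δ f h hf, totalDegree_mul_of_isDomain h0 hh] at h1
    omega

/-- substitute `a` for the first variable, keep the second -/
noncomputable def toPoly (a : R3) : R2 →ₐ[ℂ] Polynomial R3 :=
  aeval ![Polynomial.C a, Polynomial.X]

lemma toPoly_eq_sum (a : R3) (Q : R2) :
    toPoly a Q = ∑ s ∈ Q.support, Polynomial.monomial (s 1) (coeff s Q • a ^ s 0) := by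
  conv_lhs => rw [Q.as_sum]
  rw [map_sum]
  apply Finset.sum_congr rfl
  intro s _
  rw [toPoly, aeval_monomial_two, ← Polynomial.C_pow, Polynomial.C_mul_X_pow_eq_monomial,
    Polynomial.smul_monomial]

lemma eval_toPoly (a b : R3) (Q : R2) : (toPoly a Q).eval b = aeval ![a, b] Q := by
  conv_rhs => rw [Q.as_sum, map_sum]
  rw [toPoly_eq_sum, Polynomial.eval_finsetSum]
  apply Finset.sum_congr rfl
  intro s _
  rw [aeval_monomial_two, Polynomial.eval_monomial, smul_mul_assoc]

lemma toPoly_pderiv (a : R3) (Q : R2) :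
    toPoly a (pderiv 1 Q) = Polynomial.derivative (toPoly a Q) := by
  induction Q using MvPolynomial.induction_on with
  | C c =>
    rw [pderiv_C, map_zero, toPoly, aeval_C, Polynomial.algebraMap_apply, Polynomial.derivative_C]
  | add p q hp hq => rw [map_add, map_add, map_add, map_add, hp, hq]
  | mul_X p i hp =>
    rw [map_mul (toPoly a), Polynomial.derivative_mul, ← hp, Derivation.leibniz]
    fin_cases i
    · simp [pderiv_X, toPoly]; ring
    · simp [pderiv_X, toPoly]; ring

lemma toPoly_pderiv_iter (a : R3) (m : ℕ) (Q : R2) :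
    toPoly a ((pderiv 1)^[m] Q) = Polynomial.derivative^[m] (toPoly a Q) := by
  induction m with
  | zero => rfl
  | succ m ih => rw [Function.iterate_succ_apply', Function.iterate_succ_apply', toPoly_pderiv, ih]

lemma toPoly_ne_zero {d D : ℕ} {Q : R2} (hQ : ∀ s ∈ Q.support, s 0 * 3 + s 1 * d = D)
    (hQ0 : Q ≠ 0) {a : R3} (ha : a ≠ 0) : toPoly a Q ≠ 0 := by
  obtain ⟨t, ht⟩ := support_nonempty.mpr hQ0
  intro h
  have h1 : (toPoly a Q).coeff (t 1) = 0 := by rw [h, Polynomial.coeff_zero]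
  rw [toPoly_eq_sum, Polynomial.finsetSum_coeff, Finset.sum_eq_single t] at h1
  · rw [Polynomial.coeff_monomial_same, smul_eq_zero] at h1
    rcases h1 with h1 | h1
    · exact (mem_support_iff.mp ht) h1
    · exact pow_ne_zero _ ha h1
  · intro s hs hst
    apply Polynomial.coeff_monomial_of_ne
    intro h2
    apply hst
    have e1 := hQ s hs
    have e2 := hQ t ht
    rw [h2] at e2
    ext i
    fin_cases i
    · change s 0 = t 0
      omega
    · exact h2.symm
  · intro h; exact absurd ht h

lemma natDegree_toPoly {d D : ℕ} {Q : R2} (hQ : ∀ s ∈ Q.support, s 0 * 3 + s 1 * d = D)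
    (hQ0 : Q ≠ 0) {a : R3} (ha : a ≠ 0) : (toPoly a Q).natDegree * d ≤ D := by
  have h0 := toPoly_ne_zero hQ hQ0 ha
  have h1 : (toPoly a Q).coeff (toPoly a Q).natDegree ≠ 0 := by
    rwa [Polynomial.coeff_natDegree, Polynomial.leadingCoeff_ne_zero]
  generalize (toPoly a Q).natDegree = n at *
  rw [toPoly_eq_sum, Polynomial.finsetSum_coeff] at h1
  obtain ⟨s, hs, h2⟩ := Finset.exists_ne_zero_of_sum_ne_zero h1
  have h3 : s 1 = n := by
    by_contra h3
    exact h2 (Polynomial.coeff_monomial_of_ne _ (Ne.symm h3))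
  have := hQ s hs
  rw [← h3]
  omega

lemma toPoly_comp {d D : ℕ} {Q : R2} (hQ : ∀ s ∈ Q.support, s 0 * 3 + s 1 * d = D)
    (hd : ¬ 3 ∣ d) {ω : ℂ} (hω : ω ^ 3 = 1) (hω0 : ω ≠ 0) (a : R3) :
    ∃ c : ℂ, c ≠ 0 ∧
      (toPoly a Q).comp (Polynomial.C (C ω) * Polynomial.X) = Polynomial.C (C c) * toPoly a Q := by
  by_cases hQ0 : Q = 0
  · exact ⟨1, one_ne_zero, by simp [hQ0]⟩
  obtain ⟨t, ht⟩ := support_nonempty.mpr hQ0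
  refine ⟨ω ^ (t 1 % 3), pow_ne_zero _ hω0, ?_⟩
  rw [toPoly_eq_sum, Polynomial.sum_comp, Finset.mul_sum]
  apply Finset.sum_congr rfl
  intro s hs
  have e1 := hQ s hs
  have e2 := hQ t ht
  have h3 : s 1 % 3 = t 1 % 3 := by
    have h4 : (s 1 * d) % 3 = (t 1 * d) % 3 := by omega
    have hcop : Nat.gcd 3 d = 1 := (Nat.Prime.coprime_iff_not_dvd Nat.prime_three).mpr hd
    exact Nat.ModEq.cancel_right_of_coprime hcop h4
  have h5 : ω ^ s 1 = ω ^ (t 1 % 3) := by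
    rw [← h3]; exact pow_eq_pow_mod _ hω
  rw [Polynomial.monomial_comp, mul_pow, ← h5, ← Polynomial.C_pow, ← map_pow,
    ← Polynomial.C_mul_X_pow_eq_monomial]
  ring

lemma rootMult_le {d D : ℕ} {Q : R2} (hQ : ∀ s ∈ Q.support, s 0 * 3 + s 1 * d = D)
    (hd : ¬ 3 ∣ d) {ω : ℂ} (hω : ω ^ 3 = 1) (hω0 : ω ≠ 0) (hQ0 : Q ≠ 0)
    {a : R3} (ha : a ≠ 0) (b : R3) :
    (toPoly a Q).rootMultiplicity (C ω * b) ≤ (toPoly a Q).rootMultiplicity b := by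
  have h0 := toPoly_ne_zero hQ hQ0 ha
  rw [Polynomial.le_rootMultiplicity_iff h0]
  obtain ⟨p, hp⟩ := (toPoly a Q).pow_rootMultiplicity_dvd (C ω * b)
  obtain ⟨c, hc, hcomp⟩ := toPoly_comp hQ hd hω hω0 a
  set m := (toPoly a Q).rootMultiplicity (C ω * b)
  have h1 : (toPoly a Q) = Polynomial.C (C c⁻¹) *
      (toPoly a Q).comp (Polynomial.C (C ω) * Polynomial.X) := by
    rw [hcomp, ← mul_assoc, ← Polynomial.C_mul, ← C_mul, inv_mul_cancel₀ hc]; simp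
  rw [h1]
  apply Dvd.dvd.mul_left
  rw [hp, Polynomial.mul_comp]
  apply Dvd.dvd.mul_right
  rw [Polynomial.pow_comp]
  apply pow_dvd_pow_of_dvd
  refine ⟨Polynomial.C (C ω), ?_⟩
  simp
  ring

lemma three_mult_le {d D : ℕ} {Q : R2} (hQ : ∀ s ∈ Q.support, s 0 * 3 + s 1 * d = D)
    (hd : ¬ 3 ∣ d) (hQ0 : Q ≠ 0) {a b : R3} (ha : a ≠ 0) (hb : b ≠ 0) :
    3 * (toPoly a Q).rootMultiplicity b ≤ (toPoly a Q).natDegree := by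
  classical
  obtain ⟨ω, hprim⟩ : ∃ ω : ℂ, IsPrimitiveRoot ω 3 := ⟨_, Complex.isPrimitiveRoot_exp 3 (by norm_num)⟩
  have hω := hprim.pow_eq_one
  have hω0 : ω ≠ 0 := hprim.ne_zero (by norm_num)
  have hω1 : ω ≠ 1 := hprim.ne_one (by norm_num)
  have m1 := rootMult_le hQ hd hω hω0 hQ0 ha (C ω * b)
  have m2 := rootMult_le hQ hd hω hω0 hQ0 ha (C ω * (C ω * b))
  have e3 : C ω * (C ω * (C ω * b)) = b := by
    rw [← mul_assoc, ← mul_assoc, ← C_mul, ← C_mul, ← pow_two, ← pow_succ, hω]; simp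
  rw [e3] at m2
  have m3 := rootMult_le hQ hd hω hω0 hQ0 ha b
  have hne : ∀ u : R3, u ≠ 0 → C ω * u ≠ u := by
    intro u hu h
    have h1 : (C (ω - 1) : R3) * u = 0 := by rw [C_sub, sub_mul, h]; simp
    rcases mul_eq_zero.mp h1 with h2 | h2
    · rw [C_eq_zero] at h2
      exact hω1 (sub_eq_zero.mp h2)
    · exact hu h2
  have hC : (C ω : R3) ≠ 0 := by rwa [Ne, C_eq_zero]
  have n1 := hne b hb
  have n2 := hne (C ω * b) (mul_ne_zero hC hb)
  have n3 := hne (C ω * (C ω * b)) (mul_ne_zero hC (mul_ne_zero hC hb))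
  rw [e3] at n3
  have hsum : ∑ x ∈ ({b, C ω * b, C ω * (C ω * b)} : Finset R3),
      (toPoly a Q).roots.count x ≤ (toPoly a Q).natDegree := by
    refine le_trans ?_ (Polynomial.card_roots' _)
    rw [← Multiset.sum_count_eq_card
      (s := ({b, C ω * b, C ω * (C ω * b)} : Finset R3) ∪ (toPoly a Q).roots.toFinset)
      (fun x hx => Finset.mem_union_right _ (Multiset.mem_toFinset.mpr hx))]
    exact Finset.sum_le_sum_of_subset Finset.subset_union_left
  rw [Finset.sum_insert (by simp only [Finset.mem_insert, Finset.mem_singleton, not_or]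
                            exact ⟨n1.symm, n3⟩),
    Finset.sum_insert (by simp only [Finset.mem_singleton]; exact n2.symm),
    Finset.sum_singleton] at hsum
  simp only [Polynomial.count_roots] at hsum
  omega


lemma main_aux (d2 d3 : ℕ) (h2 : 3 ≤ d2) (h23 : d2 < d3) (hdvd : ¬ 3 ∣ d2) (hd3 : ¬ 3 ∣ d3)
    (f h : R3) (hf : f.totalDegree = 3) (hh : h.totalDegree = d3)
    (Δ : Derivation ℂ R3 R3) (hΔf : Δ f = 0) (hΔh : Δ h ≠ 0)
    (hΔ : ∀ u, (Δ u).totalDegree ≤ u.totalDegree + 1)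
    (G : R2) (hG : (aeval ![f, h] G).totalDegree = d2) : False := by
  classical
  have hG0 : G ≠ 0 := by
    rintro rfl
    rw [map_zero, totalDegree_zero] at hG
    omega
  obtain ⟨t, ht, hmax⟩ := Finset.exists_max_image G.support (fun s => s 0 * 3 + s 1 * d3)
    (support_nonempty.mpr hG0)
  obtain ⟨D, hD⟩ : ∃ D, D = t 0 * 3 + t 1 * d3 := ⟨_, rfl⟩
  have hW : WLe 3 d3 G D := fun s hs => by rw [hD]; exact hmax s hs
  have hW' : WLe f.totalDegree h.totalDegree G D := by rw [hf, hh]; exact hW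
  have hD2 : d2 ≤ D := hG ▸ totalDegree_aeval_le hW'
  obtain ⟨Q, hQdef⟩ : ∃ Q, Q = weightedHomogeneousComponent ![3, d3] D G := ⟨_, rfl⟩
  have hQ0 : Q ≠ 0 := by
    intro hz
    have h1 : coeff t Q = 0 := by rw [hz, coeff_zero]
    rw [hQdef, coeff_weightedHomogeneousComponent, weight_two, if_pos hD.symm] at h1
    exact (mem_support_iff.mp ht) h1
  have hQ : ∀ s ∈ Q.support, s 0 * 3 + s 1 * d3 = D := by
    intro s hs
    rw [mem_support_iff, hQdef, coeff_weightedHomogeneousComponent, weight_two] at hs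
    by_contra hne
    exact hs (if_neg hne)
  obtain ⟨a, ha⟩ : ∃ a, a = homogeneousComponent 3 f := ⟨_, rfl⟩
  obtain ⟨b, hb⟩ : ∃ b, b = homogeneousComponent d3 h := ⟨_, rfl⟩
  have htop : ∀ (p : R3) (n : ℕ), p.totalDegree = n → 0 < n → homogeneousComponent n p ≠ 0 := by
    intro p n hp hn hz
    have hp0 : p ≠ 0 := by
      rintro rfl
      rw [totalDegree_zero] at hp
      omega
    obtain ⟨s, hs, hs'⟩ := Finset.exists_mem_eq_sup p.support (support_nonempty.mpr hp0)
      (fun s => s.sum fun _ e => e)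
    have h1 : coeff s (homogeneousComponent n p) = 0 := by rw [hz, coeff_zero]
    have h2 : s.degree = n := by
      rw [← hp]; exact hs'.symm
    rw [coeff_homogeneousComponent, if_pos h2] at h1
    exact (mem_support_iff.mp hs) h1
  have ha0 : a ≠ 0 := ha ▸ htop f 3 hf (by norm_num)
  have hb0 : b ≠ 0 := hb ▸ htop h d3 hh (by omega)
  have hdeg := natDegree_toPoly hQ hQ0 ha0
  have hthree := three_mult_le hQ hd3 hQ0 ha0 hb0
  have hq0 := toPoly_ne_zero hQ hQ0 ha0
  have hev := Polynomial.eval_iterate_derivative_rootMultiplicity (p := toPoly a Q) (t := b)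
  have hne := Polynomial.eval_divByMonic_pow_rootMultiplicity_ne_zero b hq0
  generalize (toPoly a Q).rootMultiplicity b = m at *
  have hne2 : aeval ![a, b] ((pderiv 1)^[m] Q) ≠ 0 := by
    rw [← eval_toPoly, toPoly_pderiv_iter, hev]
    exact smul_ne_zero (Nat.factorial_ne_zero m) hne
  have hmD : 3 * m * d3 ≤ D := (Nat.mul_le_mul_right _ hthree).trans hdeg
  obtain ⟨E, hE⟩ : ∃ E, D = E + m * d3 := ⟨D - m * d3, by
    rw [Nat.sub_add_cancel]; nlinarith⟩
  have hlow : E ≤ (aeval ![f, h] ((pderiv 1)^[m] G)).totalDegree := by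
    by_contra! hlt
    have hz := homogeneousComponent_eq_zero _ _ hlt
    rw [hc_aeval (WLe_pderiv_iter m (by rw [hf, hh, ← hE]; exact hW)), whc_pderiv_iter, hh, hf,
      ← hE, ← hQdef, ← ha, ← hb] at hz
    exact hne2 hz
  have hup := iter_bound Δ f h hΔf hΔh hΔ m G
  rw [hG] at hup
  have hm0 : m = 0 := by
    by_contra hm
    have : 1 ≤ m := Nat.one_le_iff_ne_zero.mpr hm
    nlinarith
  subst hm0
  have hDeq : D = d2 := by omega
  have ht1 : t 1 = 0 := by
    by_contra hne
    have : 1 ≤ t 1 := Nat.one_le_iff_ne_zero.mpr hne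
    nlinarith
  rw [ht1] at hD
  omega

end NoElem

/-- Suppose `3 ≤ d2 ≤ d3`, `3 ∤ d2` and `d3 ∉ 3ℕ + d2ℕ`. If `F = (F₁, F₂, F₃)` is a polynomial
automorphism of `ℂ³` with `mdeg F = (3, d2, d3)`, then no polynomial `g ∈ ℂ[x,y]` satisfies
`deg (F₂ - g(F₁, F₃)) < d2`. -/
theorem no_elementary_reduction_second (d2 d3 : ℕ) (h2 : 3 ≤ d2) (h23 : d2 ≤ d3)
    (hdvd : ¬ 3 ∣ d2) (hmem : ¬ ∃ a b : ℕ, d3 = 3 * a + b * d2)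
    (F : MvPolynomial (Fin 3) ℂ ≃ₐ[ℂ] MvPolynomial (Fin 3) ℂ)
    (hF1 : (F (X 0)).totalDegree = 3) (hF2 : (F (X 1)).totalDegree = d2)
    (hF3 : (F (X 2)).totalDegree = d3) :
    ¬ ∃ g : MvPolynomial (Fin 2) ℂ,
      (F (X 1) - aeval ![F (X 0), F (X 2)] g).totalDegree < d2 := by
  rintro ⟨g, hg⟩
  have hlt : d2 < d3 := by
    rcases h23.lt_or_eq with h | h
    · exact h
    · exact absurd ⟨0, 1, by omega⟩ hmem
  have hd3 : ¬ 3 ∣ d3 := by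
    rintro ⟨k, hk⟩
    exact hmem ⟨k, 0, by omega⟩
  obtain ⟨Δ, h1, h3, hΔ⟩ := NoElem.exists_derivation F hF1
  refine NoElem.main_aux d2 d3 h2 hlt hdvd hd3 (F (X 0)) (F (X 2)) hF1 hF3 Δ h1 h3 hΔ g ?_
  have e : aeval ![F (X 0), F (X 2)] g
      = -(F (X 1) - aeval ![F (X 0), F (X 2)] g) + F (X 1) := by ring
  rw [e, totalDegree_add_eq_right_of_totalDegree_lt, hF2]
  rw [totalDegree_neg, hF2]
  exact hg
end

section
/- Let d2, d3 be integers with 3 ≤ d2 ≤ d3 such that 3 does not divide d2 and d3 cannot be written as 3a + b·d2 with natural numbers a, b. Let F = (F₁,F₂,F₃) be a polynomial automorphism of ℂ³ with deg F₁ = 3, deg F₂ = d2, deg F₃ = d3. Then there is no polynomial g ∈ ℂ[x,y] such that deg(F₁ − g(F₂,F₃)) < 3. -/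
open MvPolynomial

namespace NoElemRed

abbrev R3 := MvPolynomial (Fin 3) ℂ

lemma chain {σ : Type*} [Fintype σ] [DecidableEq σ] (D : Derivation ℂ R3 R3) (v : σ → R3)
    (p : MvPolynomial σ ℂ) :
    D (aeval v p) = ∑ i, aeval v (pderiv i p) * D (v i) := by
  induction p using MvPolynomial.induction_on with
  | C a => simp [MvPolynomial.algebraMap_eq, ← MvPolynomial.algebraMap_eq]
  | add p q hp hq => simp only [map_add, hp, hq, add_mul, Finset.sum_add_distrib]
  | mul_X p n hp =>
    simp only [map_mul, aeval_X, Derivation.leibniz, hp, smul_eq_mul, map_add, add_mul,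
      Finset.sum_add_distrib, pderiv_X, Finset.mul_sum]
    congr 1
    · rw [Finset.sum_eq_single n]
      · simp
      · intro b _ hb
        simp [Pi.single_apply, hb.symm]
      · simp
    · exact Finset.sum_congr rfl fun i _ => by ring

lemma deg_pderiv (i : Fin 3) (p : R3) (h : pderiv i p ≠ 0) :
    (pderiv i p).totalDegree + 1 ≤ p.totalDegree := by
  obtain ⟨m, hm, hm'⟩ := Finset.exists_mem_eq_sup (pderiv i p).support
    (by simpa [Finset.nonempty_iff_ne_empty] using h) (fun s => s.sum fun _ e => e)
  have h1 : (pderiv i p).totalDegree = m.sum fun _ e => e := hm'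
  rw [mem_support_iff, coeff_pderiv] at hm
  have h2 : m + Finsupp.single i 1 ∈ p.support := by
    rw [mem_support_iff]; intro h; simp [h] at hm
  have h3 := le_totalDegree h2
  rw [Finsupp.sum_add_index' (by simp) (by simp)] at h3
  simp at h3
  omega

lemma minor_ne (F : R3 ≃ₐ[ℂ] R3) : ∃ a b : Fin 3,
    pderiv a (F (X 1)) * pderiv b (F (X 2)) - pderiv b (F (X 1)) * pderiv a (F (X 2)) ≠ 0 := by
  by_contra! hcon
  let A : Matrix (Fin 3) (Fin 3) R3 := fun k i => aeval (fun i => F (X i)) (pderiv i (F.symm (X k)))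
  let J : Matrix (Fin 3) (Fin 3) R3 := fun i l => pderiv l (F (X i))
  have hF : ∀ p, aeval (fun i => F (X i)) p = F p := by
    intro p
    have : aeval (fun i => F (X i)) = (F : R3 →ₐ[ℂ] R3) := by ext1; simp
    rw [this]; rfl
  have hAJ : A * J = 1 := by
    ext1 k l
    have := chain (pderiv l) (fun i => F (X i)) (F.symm (X k))
    rw [hF, AlgEquiv.apply_symm_apply] at this
    rw [Matrix.mul_apply]
    change ∑ i, aeval (fun i => F (X i)) (pderiv i (F.symm (X k))) * pderiv l (F (X i)) = _
    rw [← this, pderiv_X, Matrix.one_apply, Pi.single_apply]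
  have hd := congrArg Matrix.det hAJ
  rw [Matrix.det_mul, Matrix.det_one] at hd
  have hJ : J.det = 0 := by
    rw [Matrix.det_fin_three]
    change pderiv 0 (F (X 0)) * pderiv 1 (F (X 1)) * pderiv 2 (F (X 2)) -
      pderiv 0 (F (X 0)) * pderiv 2 (F (X 1)) * pderiv 1 (F (X 2)) -
      pderiv 1 (F (X 0)) * pderiv 0 (F (X 1)) * pderiv 2 (F (X 2)) +
      pderiv 1 (F (X 0)) * pderiv 2 (F (X 1)) * pderiv 0 (F (X 2)) +
      pderiv 2 (F (X 0)) * pderiv 0 (F (X 1)) * pderiv 1 (F (X 2)) -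
      pderiv 2 (F (X 0)) * pderiv 1 (F (X 1)) * pderiv 0 (F (X 2)) = 0
    linear_combination pderiv 0 (F (X 0)) * hcon 1 2 - pderiv 1 (F (X 0)) * hcon 0 2
      + pderiv 2 (F (X 0)) * hcon 0 1
  simp [hJ] at hd

lemma deg_minor (a b : Fin 3) (f h : R3) (hne : pderiv a f * pderiv b h - pderiv b f * pderiv a h ≠ 0) :
    (pderiv a f * pderiv b h - pderiv b f * pderiv a h).totalDegree + 2 ≤
      f.totalDegree + h.totalDegree := by
  have key : ∀ a b : Fin 3, pderiv a f * pderiv b h ≠ 0 →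
      (pderiv a f * pderiv b h).totalDegree + 2 ≤ f.totalDegree + h.totalDegree := by
    intro a b hn
    have h1 := deg_pderiv a f (left_ne_zero_of_mul hn)
    have h2 := deg_pderiv b h (right_ne_zero_of_mul hn)
    have h3 := totalDegree_mul (pderiv a f) (pderiv b h)
    omega
  have hs := totalDegree_sub (pderiv a f * pderiv b h) (pderiv b f * pderiv a h)
  by_cases h1 : pderiv a f * pderiv b h = 0
  · by_cases h2 : pderiv b f * pderiv a h = 0
    · simp [h1, h2] at hne
    · have := key b a h2
      simp only [h1, totalDegree_zero] at hs ⊢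
      omega
  · have k1 := key a b h1
    by_cases h2 : pderiv b f * pderiv a h = 0
    · simp only [h2, totalDegree_zero] at hs ⊢
      omega
    · have := key b a h2
      omega

lemma deg_step (f g : R3) (a b : Fin 3)
    (hM : pderiv a f * pderiv b g - pderiv b f * pderiv a g ≠ 0)
    (G : MvPolynomial (Fin 2) ℂ) (hn : aeval ![f, g] (pderiv 1 G) ≠ 0) :
    (aeval ![f, g] (pderiv 1 G)).totalDegree + 2 ≤
      f.totalDegree + (aeval ![f, g] G).totalDegree := by
  have e : pderiv a f * pderiv b (aeval ![f, g] G) - pderiv b f * pderiv a (aeval ![f, g] G)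
      = aeval ![f, g] (pderiv 1 G) * (pderiv a f * pderiv b g - pderiv b f * pderiv a g) := by
    rw [chain (pderiv a), chain (pderiv b)]
    simp only [Fin.sum_univ_two, Matrix.cons_val_zero, Matrix.cons_val_one]
    ring
  have h0 : aeval ![f, g] (pderiv 1 G) * (pderiv a f * pderiv b g - pderiv b f * pderiv a g) ≠ 0 :=
    mul_ne_zero hn hM
  have h1 := deg_minor a b f (aeval ![f, g] G) (by rw [e]; exact h0)
  rw [e, totalDegree_mul_of_isDomain hn hM] at h1
  omega

lemma coeff_E (c : ℂ) (G : MvPolynomial (Fin 2) ℂ) (m : Fin 2 →₀ ℕ) :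
    coeff m (X 1 * pderiv 1 G - C c * G) = ((m 1 : ℂ) - c) * coeff m G := by
  have : coeff m (X 1 * pderiv 1 G) = (m 1 : ℂ) * coeff m G := by
    induction G using MvPolynomial.induction_on' with
    | monomial u a =>
      rw [X_mul_pderiv_monomial, coeff_smul, coeff_monomial]
      split_ifs with h
      · simp [h]
      · simp
    | add p q hp hq => rw [map_add, mul_add, coeff_add, hp, hq, coeff_add, mul_add]
  rw [coeff_sub, this, coeff_C_mul]; ring

lemma iterate (f g : R3) (a b : Fin 3) (hfg : 2 ≤ f.totalDegree + g.totalDegree)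
    (hM : pderiv a f * pderiv b g - pderiv b f * pderiv a g ≠ 0)
    (G : MvPolynomial (Fin 2) ℂ) (S : Finset ℕ) :
    ∃ G' : MvPolynomial (Fin 2) ℂ,
      (∀ m, coeff m G' = (∏ c ∈ S, ((m 1 : ℂ) - (c : ℂ))) * coeff m G) ∧
      (aeval ![f, g] G').totalDegree ≤ (aeval ![f, g] G).totalDegree
        + S.card * (f.totalDegree + g.totalDegree - 2) := by
  induction S using Finset.induction_on with
  | empty => exact ⟨G, by simp, by simp⟩
  | insert c S hc ih =>
    obtain ⟨G', h1, h2⟩ := ih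
    refine ⟨X 1 * pderiv 1 G' - C (c : ℂ) * G', fun m => ?_, ?_⟩
    · rw [coeff_E, h1, Finset.prod_insert hc, mul_assoc]
    · rw [Finset.card_insert_of_notMem hc, add_mul, one_mul]
      have hb : (aeval ![f, g] (C (c : ℂ) * G')).totalDegree ≤ (aeval ![f, g] G').totalDegree := by
        rw [map_mul, aeval_C, MvPolynomial.algebraMap_eq]
        refine (totalDegree_mul _ _).trans ?_
        rw [totalDegree_C, zero_add]
      have ha : (aeval ![f, g] (X 1 * pderiv 1 G')).totalDegree ≤ (aeval ![f, g] G').totalDegree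
          + (f.totalDegree + g.totalDegree - 2) := by
        rw [map_mul, aeval_X]
        by_cases hn : aeval ![f, g] (pderiv 1 G') = 0
        · rw [hn, mul_zero, totalDegree_zero]; omega
        · have := deg_step f g a b hM G' hn
          have h3 := totalDegree_mul (![f, g] 1) (aeval ![f, g] (pderiv 1 G'))
          simp only [Matrix.cons_val_one, Matrix.cons_val_zero] at h3 ⊢
          omega
      rw [map_sub]
      refine (totalDegree_sub _ _).trans (max_le ?_ ?_) <;> omega

lemma deg_mon (f g : R3) (m : Fin 2 →₀ ℕ) (a : ℂ) :
    (aeval ![f, g] (monomial m a)).totalDegree ≤ m 0 * f.totalDegree + m 1 * g.totalDegree := by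
  rw [aeval_monomial, Finsupp.prod_fintype _ _ (by simp), Fin.prod_univ_two,
    MvPolynomial.algebraMap_eq]
  simp only [Matrix.cons_val_one, Matrix.cons_val_zero]
  have h1 := totalDegree_mul (C a : R3) (f ^ m 0 * g ^ m 1)
  have h2 := totalDegree_mul (f ^ m 0) (g ^ m 1)
  have h3 := totalDegree_pow f (m 0)
  have h4 := totalDegree_pow g (m 1)
  rw [totalDegree_C] at h1
  omega

lemma deg_pow (f : R3) (hf : f ≠ 0) (n : ℕ) : (f ^ n).totalDegree = n * f.totalDegree := by
  induction n with
  | zero => simp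
  | succ n ih => rw [pow_succ, totalDegree_mul_of_isDomain (pow_ne_zero _ hf) hf, ih]; ring

lemma deg_mon_eq (f g : R3) (hf : f ≠ 0) (hg : g ≠ 0) (m : Fin 2 →₀ ℕ) (a : ℂ) (ha : a ≠ 0) :
    (aeval ![f, g] (monomial m a)).totalDegree = m 0 * f.totalDegree + m 1 * g.totalDegree := by
  rw [aeval_monomial, Finsupp.prod_fintype _ _ (by simp), Fin.prod_univ_two,
    MvPolynomial.algebraMap_eq]
  simp only [Matrix.cons_val_one, Matrix.cons_val_zero]
  rw [totalDegree_mul_of_isDomain (by simpa using ha)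
    (mul_ne_zero (pow_ne_zero _ hf) (pow_ne_zero _ hg)),
    totalDegree_mul_of_isDomain (pow_ne_zero _ hf) (pow_ne_zero _ hg), totalDegree_C,
    deg_pow f hf, deg_pow g hg, zero_add]

lemma deg_lower (f g : R3) (hf : f ≠ 0) (hg : g ≠ 0) (P : MvPolynomial (Fin 2) ℂ)
    (m : Fin 2 →₀ ℕ) (hm : coeff m P ≠ 0)
    (hlt : ∀ n, coeff n P ≠ 0 → n ≠ m → n 0 * f.totalDegree + n 1 * g.totalDegree <
      m 0 * f.totalDegree + m 1 * g.totalDegree) :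
    m 0 * f.totalDegree + m 1 * g.totalDegree ≤ (aeval ![f, g] P).totalDegree := by
  rcases Nat.eq_zero_or_pos (m 0 * f.totalDegree + m 1 * g.totalDegree) with h0 | h0
  · omega
  have hP : P = monomial m (coeff m P) + ∑ n ∈ P.support.erase m, monomial n (coeff n P) := by
    rw [Finset.add_sum_erase _ (fun n => monomial n (coeff n P)) (by simpa using hm)]
    exact P.as_sum
  have h1 := deg_mon_eq f g hf hg m _ hm
  have h2 : (aeval ![f, g] (∑ n ∈ P.support.erase m, monomial n (coeff n P))).totalDegree <
      m 0 * f.totalDegree + m 1 * g.totalDegree := by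
    rw [map_sum]
    refine lt_of_le_of_lt (totalDegree_finsetSum _ _) ?_
    rw [Finset.sup_lt_iff h0]
    intro n hn
    rw [Finset.mem_erase, mem_support_iff] at hn
    exact lt_of_le_of_lt (deg_mon f g n _) (hlt n hn.2 hn.1)
  rw [hP, map_add, totalDegree_add_eq_left_of_totalDegree_lt (by rw [h1]; exact h2), h1]

/-- counting lemma -/
lemma count (d2 d3 w : ℕ) (h2 : 0 < d2) (h3 : 0 < d3) (J : Finset ℕ)
    (hJ : ∀ j ∈ J, ∃ i, i * d2 + j * d3 = w) :
    J.card ≤ w / (d2 / d2.gcd d3 * d3) + 1 := by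
  have hg : 0 < d2.gcd d3 := Nat.gcd_pos_of_pos_left _ h2
  have hp : 0 < d2 / d2.gcd d3 := Nat.div_pos (Nat.gcd_le_left _ h2) hg
  set p := d2 / d2.gcd d3 with hpdef
  have hmod : ∀ j ∈ J, ∀ j' ∈ J, j ≤ j' → p ∣ j' - j := by
    intro j hj j' hj' hle
    obtain ⟨i, hi⟩ := hJ j hj
    obtain ⟨i', hi'⟩ := hJ j' hj'
    have : d2 ∣ d3 * (j' - j) := by
      have e : (i - i') * d2 = (j' - j) * d3 := by
        rw [Nat.sub_mul, Nat.sub_mul]; omega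
      exact ⟨i - i', by rw [mul_comm d3, ← e, mul_comm]⟩
    have hcop : Nat.Coprime p (d3 / d2.gcd d3) := Nat.coprime_div_gcd_div_gcd hg
    have h' : p ∣ (d3 / d2.gcd d3) * (j' - j) := by
      apply Nat.dvd_of_mul_dvd_mul_left hg
      rw [hpdef, Nat.mul_div_cancel' (Nat.gcd_dvd_left _ _), ← mul_assoc,
        Nat.mul_div_cancel' (Nat.gcd_dvd_right _ _)]
      exact this
    exact hcop.dvd_of_dvd_mul_left h'
  have key : ∀ j ∈ J, ∀ j' ∈ J, j ≤ j' → j / p = j' / p → j = j' := by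
    intro j hj j' hj' hle he
    obtain ⟨k, hk⟩ := hmod j hj j' hj' hle
    have : j' = j + p * k := by omega
    rw [this, Nat.add_mul_div_left _ _ hp] at he
    have : k = 0 := by omega
    subst this; omega
  have : J.card ≤ (Finset.range (w / (p * d3) + 1)).card := by
    apply Finset.card_le_card_of_injOn (fun j => j / p)
    · intro j hj
      obtain ⟨i, hi⟩ := hJ j hj
      simp only [Finset.coe_range, Set.mem_Iio]
      rw [mul_comm p, ← Nat.div_div_eq_div_mul, Nat.lt_succ_iff]
      apply Nat.div_le_div_right
      rw [Nat.le_div_iff_mul_le h3]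
      omega
    · intro j hj j' hj' he
      rcases le_total j j' with h | h
      · exact key j hj j' hj' h he
      · exact (key j' hj' j hj h he.symm).symm
  simpa using this

lemma arith (d2 d3 w k : ℕ) (h2 : 4 ≤ d2) (h23 : d2 ≤ d3) (hnd : ¬ d2 ∣ d3)
    (hk : k ≤ w / (d2 / d2.gcd d3 * d3)) (hw : w ≤ 3 + k * (d2 + d3 - 2)) : k = 0 := by
  by_contra hk0
  have hg : 0 < d2.gcd d3 := Nat.gcd_pos_of_pos_left _ (by omega)
  obtain ⟨p, hp⟩ := Nat.gcd_dvd_left d2 d3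
  obtain ⟨s, hs⟩ := Nat.gcd_dvd_right d2 d3
  have hpp : d2 / d2.gcd d3 = p := Nat.div_eq_of_eq_mul_right hg hp
  rw [hpp] at hk
  have hk' : k * (p * d3) ≤ w := (Nat.mul_le_mul_right _ hk).trans (Nat.div_mul_le_self _ _)
  generalize d2.gcd d3 = g at *
  have hb : d2 + d3 + 2 ≤ p * d3 := by
    rcases Nat.lt_or_ge p 3 with h | h
    · interval_cases p
      · omega
      · exact absurd ⟨s, by rw [hs, hp, mul_one]⟩ hnd
      · have hs3 : 3 ≤ s := by
          by_contra hs3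
          interval_cases s
          · omega
          · omega
          · exact hnd ⟨1, by omega⟩
        have : g * 3 ≤ g * s := Nat.mul_le_mul_left _ hs3
        omega
    · have : 3 * d3 ≤ p * d3 := Nat.mul_le_mul_right _ h
      omega
  have h4 : k * (d2 + d3 + 2) ≤ k * (p * d3) := Nat.mul_le_mul_left _ hb
  have h5 : d2 + d3 + 2 = (d2 + d3 - 2) + 4 := by omega
  rw [h5, mul_add] at h4
  omega

lemma main (f g : R3) (a b : Fin 3)
    (hM : pderiv a f * pderiv b g - pderiv b f * pderiv a g ≠ 0)
    (h2 : 4 ≤ f.totalDegree) (h23 : f.totalDegree ≤ g.totalDegree)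
    (hnd : ¬ f.totalDegree ∣ g.totalDegree)
    (G : MvPolynomial (Fin 2) ℂ) (hG : (aeval ![f, g] G).totalDegree ≤ 3) :
    (aeval ![f, g] G).totalDegree = 0 := by
  have hf : f ≠ 0 := by rintro rfl; simp at h2
  have hg : g ≠ 0 := by rintro rfl; simp at h23; omega
  by_cases hG0 : G = 0
  · simp [hG0]
  let W : (Fin 2 →₀ ℕ) → ℕ := fun m => m 0 * f.totalDegree + m 1 * g.totalDegree
  obtain ⟨m, hm, hmax⟩ := Finset.exists_max_image G.support W
    (by simpa [Finset.nonempty_iff_ne_empty] using hG0)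
  let S0 := G.support.filter (fun n => W n = W m)
  have hinj : ∀ n ∈ S0, ∀ n' ∈ S0, n 1 = n' 1 → n = n' := by
    intro n hn n' hn' he
    have h1 : W n = W n' := (Finset.mem_filter.1 hn).2.trans (Finset.mem_filter.1 hn').2.symm
    simp only [W, he, add_left_inj] at h1
    have h0 : n 0 = n' 0 := Nat.eq_of_mul_eq_mul_right (by omega) h1
    ext i
    fin_cases i
    · exact h0
    · exact he
  have hmS : m ∈ S0 := Finset.mem_filter.2 ⟨hm, rfl⟩
  let J := S0.image (fun n => n 1)
  have hmJ : m 1 ∈ J := Finset.mem_image_of_mem _ hmS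
  have hJ := count f.totalDegree g.totalDegree (W m) (by omega) (by omega) J (by
    intro j hj
    obtain ⟨n, hn, rfl⟩ := Finset.mem_image.1 hj
    exact ⟨n 0, (Finset.mem_filter.1 hn).2⟩)
  obtain ⟨G', hc, hd⟩ := iterate f g a b (by omega) hM G (J.erase (m 1))
  have hlow := deg_lower f g hf hg G' m (by
      rw [hc]
      refine mul_ne_zero (Finset.prod_ne_zero_iff.2 fun c hcJ => ?_) (mem_support_iff.1 hm)
      rw [sub_ne_zero]
      exact_mod_cast (Finset.ne_of_mem_erase hcJ).symm) (by
      intro n hn hne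
      rw [hc] at hn
      have hns : n ∈ G.support := mem_support_iff.2 (right_ne_zero_of_mul hn)
      refine lt_of_le_of_ne (hmax n hns) fun he => ?_
      have hnS : n ∈ S0 := Finset.mem_filter.2 ⟨hns, he⟩
      have : n 1 ∈ J.erase (m 1) := Finset.mem_erase.2
        ⟨fun h => hne (hinj n hnS m hmS h), Finset.mem_image_of_mem _ hnS⟩
      exact left_ne_zero_of_mul hn (Finset.prod_eq_zero this (by simp)))
  have hcard : (J.erase (m 1)).card + 1 = J.card := Finset.card_erase_add_one hmJ
  change W m ≤ _ at hlow
  have hk := arith f.totalDegree g.totalDegree (W m) (J.erase (m 1)).card h2 h23 hnd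
    (by omega) (by omega)
  rw [hk, zero_mul] at hd
  have hW : W m ≤ 3 := by omega
  rw [← Nat.le_zero, G.as_sum, map_sum]
  refine (totalDegree_finsetSum _ _).trans (Finset.sup_le fun n hn => ?_)
  refine (deg_mon f g n _).trans ?_
  have h6 : n 0 * f.totalDegree + n 1 * g.totalDegree ≤ 3 := (hmax n hn).trans hW
  have h7 : n 0 = 0 := by
    by_contra h
    have := Nat.mul_le_mul_right f.totalDegree (Nat.one_le_iff_ne_zero.2 h)
    omega
  have h8 : n 1 = 0 := by
    by_contra h
    have := Nat.mul_le_mul_right g.totalDegree (Nat.one_le_iff_ne_zero.2 h)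
    omega
  simp [h7, h8]

end NoElemRed

/-- Suppose `3 ≤ d2 ≤ d3`, `3 ∤ d2` and `d3 ∉ 3ℕ + d2ℕ`. If `F = (F₁, F₂, F₃)` is a polynomial
automorphism of `ℂ³` with `mdeg F = (3, d2, d3)`, then no polynomial `g ∈ ℂ[x,y]` satisfies
`deg (F₁ - g(F₂, F₃)) < 3`. -/
theorem no_elementary_reduction_first (d2 d3 : ℕ) (h2 : 3 ≤ d2) (h23 : d2 ≤ d3)
    (hdvd : ¬ 3 ∣ d2) (hmem : ¬ ∃ a b : ℕ, d3 = 3 * a + b * d2)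
    (F : MvPolynomial (Fin 3) ℂ ≃ₐ[ℂ] MvPolynomial (Fin 3) ℂ)
    (hF1 : (F (X 0)).totalDegree = 3) (hF2 : (F (X 1)).totalDegree = d2)
    (hF3 : (F (X 2)).totalDegree = d3) :
    ¬ ∃ g : MvPolynomial (Fin 2) ℂ,
      (F (X 0) - aeval ![F (X 1), F (X 2)] g).totalDegree < 3 := by
  rintro ⟨G, hG⟩
  obtain ⟨a, b, hM⟩ := NoElemRed.minor_ne F
  have e1 := totalDegree_sub (F (X 0)) (F (X 0) - aeval ![F (X 1), F (X 2)] G)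
  have e2 := totalDegree_add (F (X 0) - aeval ![F (X 1), F (X 2)] G)
    (aeval ![F (X 1), F (X 2)] G)
  rw [sub_sub_cancel] at e1
  rw [sub_add_cancel] at e2
  have := NoElemRed.main (F (X 1)) (F (X 2)) a b hM (by omega) (by omega)
    (by
      rw [hF2, hF3]
      rintro ⟨c, hc⟩
      exact hmem ⟨0, c, by rw [hc]; ring⟩) G (by omega)
  omega
end

section
/- Let d2, d3 be integers with 3 ≤ d2 ≤ d3 such that 3 does not divide d2 and d3 cannot be written as 3a + b·d2 with natural numbers a, b. Let F = (F₁,F₂,F₃) be a polynomial automorphism of ℂ³ with deg F₁ = 3, deg F₂ = d2, deg F₃ = d3. Then F admits no elementary reduction; that is, there is no permutation σ of {1,2,3} and polynomial g ∈ ℂ[x,y] such that deg(F_{σ(1)} − g(F_{σ(2)}, F_{σ(3)})) < deg F_{σ(1)}. -/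
open MvPolynomial

/-- `h` has total degree `< n` (with `deg 0 = -∞`). -/
def DegLt (n : ℕ) (h : MvPolynomial (Fin 3) ℂ) : Prop :=
  ∀ d : Fin 3 →₀ ℕ, n ≤ d.degree → coeff d h = 0

lemma DegLt.zero (n : ℕ) : DegLt n 0 := fun d _ => by simp

lemma DegLt.add {n : ℕ} {h k : MvPolynomial (Fin 3) ℂ} (hh : DegLt n h) (hk : DegLt n k) :
    DegLt n (h + k) := fun d hd => by simp [hh d hd, hk d hd]

lemma DegLt.sub {n : ℕ} {h k : MvPolynomial (Fin 3) ℂ} (hh : DegLt n h) (hk : DegLt n k) :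
    DegLt n (h - k) := fun d hd => by simp [hh d hd, hk d hd]

lemma DegLt.sum {ι : Type*} {n : ℕ} (s : Finset ι) (u : ι → MvPolynomial (Fin 3) ℂ)
    (hu : ∀ i ∈ s, DegLt n (u i)) : DegLt n (∑ i ∈ s, u i) := fun d hd => by
  rw [coeff_sum]
  exact Finset.sum_eq_zero fun i hi => hu i hi d hd

lemma DegLt.mono {n m : ℕ} (hnm : n ≤ m) {h : MvPolynomial (Fin 3) ℂ} (hh : DegLt n h) :
    DegLt m h := fun d hd => hh d (hnm.trans hd)

lemma DegLt.mul {a b : ℕ} {h k : MvPolynomial (Fin 3) ℂ} (hh : DegLt a h)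
    (hk : DegLt (b + 1) k) : DegLt (a + b) (h * k) := fun d hd => by
  classical
  rw [coeff_mul]
  refine Finset.sum_eq_zero fun x hx => ?_
  have hx' : x.1 + x.2 = d := by simpa using hx
  have : x.1.degree + x.2.degree = d.degree := by rw [← hx', map_add]
  by_cases h1 : a ≤ x.1.degree
  · rw [hh _ h1, zero_mul]
  · rw [hk _ (by omega), mul_zero]

lemma DegLt.mul' {a b : ℕ} {h k : MvPolynomial (Fin 3) ℂ} (hh : DegLt (a + 1) h)
    (hk : DegLt b k) : DegLt (a + b) (h * k) := by
  rw [mul_comm, add_comm]; exact hk.mul hh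

lemma DegLt.pderiv {n : ℕ} {h : MvPolynomial (Fin 3) ℂ} (hh : DegLt (n + 1) h) (i : Fin 3) :
    DegLt n (pderiv i h) := fun d hd => by
  rw [coeff_pderiv, hh _ (by simp; omega), zero_mul]

lemma degLt_totalDegree (h : MvPolynomial (Fin 3) ℂ) : DegLt (h.totalDegree + 1) h :=
  fun d hd => coeff_eq_zero_of_totalDegree_lt (by
    have : d.degree = ∑ i ∈ d.support, d i := rfl
    omega)

lemma DegLt.totalDegree_lt {n : ℕ} {h : MvPolynomial (Fin 3) ℂ} (hh : DegLt n h) (h0 : h ≠ 0) :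
    h.totalDegree < n := by
  by_contra hcon
  push Not at hcon
  obtain ⟨d, hd, hd'⟩ := Finset.exists_mem_eq_sup h.support (by simpa using h0)
    (fun s => s.sum fun _ e => e)
  have h1 : h.totalDegree = d.degree := hd'
  exact (mem_support_iff.1 hd) (hh d (by omega))

lemma isHomogeneous_degLt {n : ℕ} {h : MvPolynomial (Fin 3) ℂ} (hh : h.IsHomogeneous n) :
    DegLt (n + 1) h := fun d hd => hh.coeff_eq_zero (by omega)

/-- `a` is the homogeneous part of degree `n` of `h`, and `h` has degree at most `n`. -/
def IsTopForm (n : ℕ) (h a : MvPolynomial (Fin 3) ℂ) : Prop :=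
  a.IsHomogeneous n ∧ DegLt n (h - a)

lemma IsTopForm.degLt {n : ℕ} {h a : MvPolynomial (Fin 3) ℂ} (t : IsTopForm n h a) : DegLt (n + 1) h := by
  have := (t.2.mono (Nat.le_succ n)).add (isHomogeneous_degLt t.1)
  simpa using this

lemma IsTopForm.mul {n m : ℕ} {h a k b : MvPolynomial (Fin 3) ℂ} (t : IsTopForm n h a)
    (t' : IsTopForm m k b) : IsTopForm (n + m) (h * k) (a * b) := by
  refine ⟨t.1.mul t'.1, ?_⟩
  have e : h * k - a * b = (h - a) * k + a * (k - b) := by ring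
  rw [e]
  exact (t.2.mul t'.degLt).add ((isHomogeneous_degLt t.1).mul' t'.2)

lemma isTop_C (c : ℂ) : IsTopForm 0 (C c) (C c) :=
  ⟨isHomogeneous_C _ _, by simpa using DegLt.zero 0⟩

lemma IsTopForm.pow {n : ℕ} {h a : MvPolynomial (Fin 3) ℂ} (t : IsTopForm n h a) (k : ℕ) :
    IsTopForm (k * n) (h ^ k) (a ^ k) := by
  induction k with
  | zero => simpa using isTop_C 1
  | succ k ih => rw [pow_succ, pow_succ, Nat.succ_mul]; exact ih.mul t

lemma isTop_self (h : MvPolynomial (Fin 3) ℂ) :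
    IsTopForm h.totalDegree h (homogeneousComponent h.totalDegree h) := by
  refine ⟨homogeneousComponent_isHomogeneous _ _, fun d hd => ?_⟩
  rw [coeff_sub, coeff_homogeneousComponent]
  split_ifs with h1
  · simp
  · rw [degLt_totalDegree h d (by omega), sub_zero]

lemma IsTopForm.totalDegree {n : ℕ} {h a : MvPolynomial (Fin 3) ℂ} (t : IsTopForm n h a) (ha : a ≠ 0) :
    h ≠ 0 ∧ h.totalDegree = n := by
  have h0 : ∃ d, d.degree = n ∧ coeff d a ≠ 0 := by
    by_contra! hcon
    apply ha
    ext d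
    by_cases hd : d.degree = n
    · simpa using hcon d hd
    · simpa using t.1.coeff_eq_zero hd
  obtain ⟨d, hd, hd'⟩ := h0
  have h1 : coeff d h ≠ 0 := by
    have := t.2 d hd.ge
    rw [coeff_sub, sub_eq_zero] at this
    rwa [this]
  have hne : h ≠ 0 := by rintro rfl; simp at h1
  refine ⟨hne, le_antisymm (Nat.lt_succ_iff.1 (t.degLt.totalDegree_lt hne)) ?_⟩
  by_contra! hlt
  exact h1 (degLt_totalDegree h d (by omega))

lemma top_ne_zero {h : MvPolynomial (Fin 3) ℂ} (h0 : h ≠ 0) :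
    homogeneousComponent h.totalDegree h ≠ 0 := by
  intro hz
  have t := isTop_self h
  rw [hz] at t
  have := t.2
  rw [sub_zero] at this
  exact lt_irrefl _ (this.totalDegree_lt h0)

/-- The Jacobian derivation attached to `f`. -/
noncomputable def jacD (f : MvPolynomial (Fin 3) ℂ) (a b : Fin 3) :
    Derivation ℂ (MvPolynomial (Fin 3) ℂ) (MvPolynomial (Fin 3) ℂ) :=
  (pderiv a f) • pderiv b - (pderiv b f) • pderiv a

lemma jacD_apply (f h : MvPolynomial (Fin 3) ℂ) (a b : Fin 3) :
    jacD f a b h = pderiv a f * pderiv b h - pderiv b f * pderiv a h := by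
  simp [jacD]

lemma jacD_self (f : MvPolynomial (Fin 3) ℂ) (a b : Fin 3) : jacD f a b f = 0 := by
  rw [jacD_apply]; ring

lemma jacD_degree (f h : MvPolynomial (Fin 3) ℂ) (hf : 0 < f.totalDegree) (a b : Fin 3)
    (h0 : jacD f a b h ≠ 0) :
    (jacD f a b h).totalDegree + 2 ≤ f.totalDegree + h.totalDegree := by
  have hf' : ∀ i, DegLt (f.totalDegree - 1 + 1) (pderiv i f) := fun i => by
    rw [Nat.sub_add_cancel hf]; exact (degLt_totalDegree f).pderiv i
  have hh' : ∀ i, DegLt h.totalDegree (pderiv i h) := fun i => (degLt_totalDegree h).pderiv i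
  have : DegLt (f.totalDegree - 1 + h.totalDegree) (jacD f a b h) := by
    rw [jacD_apply]
    exact ((hf' a).mul' (hh' b)).sub ((hf' b).mul' (hh' a))
  have := this.totalDegree_lt h0
  omega

lemma deriv_eval (D : Derivation ℂ (MvPolynomial (Fin 3) ℂ) (MvPolynomial (Fin 3) ℂ))
    (R : Polynomial (MvPolynomial (Fin 3) ℂ)) (hR : ∀ i, D (R.coeff i) = 0)
    (g : MvPolynomial (Fin 3) ℂ) :
    D (R.eval g) = R.derivative.eval g * D g := by
  rw [Polynomial.derivative_eval, Polynomial.eval_eq_sum, Polynomial.sum, Polynomial.sum, map_sum,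
    Finset.sum_mul]
  refine Finset.sum_congr rfl fun i _ => ?_
  rw [Derivation.leibniz, Derivation.leibniz_pow, hR]
  simp only [smul_eq_mul, nsmul_eq_mul]
  ring

lemma deriv_coeff (D : Derivation ℂ (MvPolynomial (Fin 3) ℂ) (MvPolynomial (Fin 3) ℂ))
    (R : Polynomial (MvPolynomial (Fin 3) ℂ)) (hR : ∀ i, D (R.coeff i) = 0) (i : ℕ) :
    D (R.derivative.coeff i) = 0 := by
  rw [Polynomial.coeff_derivative, Derivation.leibniz, hR]
  have : D ((i : MvPolynomial (Fin 3) ℂ) + 1) = 0 := by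
    rw [map_add, Derivation.map_natCast, Derivation.map_one_eq_zero, add_zero]
  simp [this]

lemma parachute (f g : MvPolynomial (Fin 3) ℂ) (hf : 0 < f.totalDegree) (a b : Fin 3)
    (hD : jacD f a b g ≠ 0) (k : ℕ) :
    ∀ (R : Polynomial (MvPolynomial (Fin 3) ℂ)) (_ : ∀ i, jacD f a b (R.coeff i) = 0)
    (_ : (Polynomial.derivative^[k] R).eval g ≠ 0), R.eval g ≠ 0 ∧
    ((Polynomial.derivative^[k] R).eval g).totalDegree + 2 * k ≤
      k * f.totalDegree + (R.eval g).totalDegree := by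
  induction k with
  | zero => intro R _ h0; simpa using h0
  | succ k ih =>
    intro R hR h0
    rw [Function.iterate_succ_apply] at h0 ⊢
    obtain ⟨h1, h2⟩ := ih _ (deriv_coeff _ R hR) h0
    have h3 := deriv_eval _ R hR g
    have h4 : jacD f a b (R.eval g) ≠ 0 := by rw [h3]; exact mul_ne_zero h1 hD
    have h5 := jacD_degree f _ hf a b h4
    rw [h3, totalDegree_mul_of_isDomain h1 hD] at h5
    refine ⟨by rintro h; rw [h] at h4; simp at h4, ?_⟩
    rw [add_mul, one_mul]
    omega

lemma mult_bound {R : Polynomial (MvPolynomial (Fin 3) ℂ)} (hR : R ≠ 0) (p : ℕ) (hp : 0 < p)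
    (hmod : ∀ i, R.coeff i ≠ 0 → i % p = R.natDegree % p) (x : MvPolynomial (Fin 3) ℂ)
    (hx : x ≠ 0) : R.rootMultiplicity x * p ≤ R.natDegree := by
  classical
  set k := R.rootMultiplicity x with hk
  have hdvd : (Polynomial.X - Polynomial.C x) ^ k ∣ R := Polynomial.pow_rootMultiplicity_dvd R x
  have key : ∀ z : ℂ, z ^ p = 1 → k ≤ R.rootMultiplicity (C z * x) := by
    intro z hz
    have hz0 : z ≠ 0 := by rintro rfl; simp [hp.ne'] at hz
    have hw : z⁻¹ ^ p = 1 := by rw [inv_pow, hz, inv_one]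
    rw [Polynomial.le_rootMultiplicity_iff hR]
    have hcomp : R.comp (Polynomial.C (C z⁻¹) * Polynomial.X) =
        Polynomial.C (C (z⁻¹ ^ R.natDegree)) * R := by
      ext1 i
      rw [Polynomial.comp_C_mul_X_coeff, Polynomial.coeff_C_mul]
      by_cases hi : R.coeff i = 0
      · simp [hi]
      · rw [pow_eq_pow_mod _ hw, ← hmod i hi, ← pow_eq_pow_mod _ hw, C_pow, mul_comm]
    have h1 := map_dvd (Polynomial.compRingHom (Polynomial.C (C z⁻¹) * Polynomial.X)) hdvd
    rw [Polynomial.coe_compRingHom_apply, Polynomial.coe_compRingHom_apply, hcomp] at h1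
    have e : ((Polynomial.X - Polynomial.C x) ^ k).comp (Polynomial.C (C z⁻¹) * Polynomial.X) =
        Polynomial.C (C z⁻¹) ^ k * (Polynomial.X - Polynomial.C (C z * x)) ^ k := by
      rw [Polynomial.pow_comp, ← mul_pow, mul_sub, ← Polynomial.C_mul, ← mul_assoc, ← C_mul,
        inv_mul_cancel₀ hz0]
      simp
    rw [e] at h1
    have hu : IsUnit (Polynomial.C (C (z⁻¹ ^ R.natDegree) : MvPolynomial (Fin 3) ℂ)) :=
      Polynomial.isUnit_C.2 ((IsUnit.mk0 _ (pow_ne_zero _ (inv_ne_zero hz0))).map C)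
    exact hu.dvd_mul_left.1 (dvd_of_mul_left_dvd h1)
  set s : Finset (MvPolynomial (Fin 3) ℂ) :=
    (Polynomial.nthRootsFinset p (1 : ℂ)).image (fun z => C z * x) with hs
  have hcard : s.card = p := by
    rw [hs, Finset.card_image_of_injective, (Complex.isPrimitiveRoot_exp p hp.ne').card_nthRootsFinset]
    intro z w hzw
    exact C_injective _ _ (mul_right_cancel₀ hx hzw)
  have hle : k • s.val ≤ R.roots := by
    rw [Multiset.le_iff_count]
    intro y
    rw [Multiset.count_nsmul, Polynomial.count_roots]
    by_cases hy : y ∈ s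
    · rw [Multiset.count_eq_one_of_mem s.nodup hy, mul_one]
      obtain ⟨z, hz, rfl⟩ := Finset.mem_image.1 hy
      exact key z ((Polynomial.mem_nthRootsFinset hp _).1 hz)
    · rw [Multiset.count_eq_zero_of_notMem hy]; simp
  have := (Multiset.card_le_card hle).trans (Polynomial.card_roots' R)
  rw [Multiset.card_nsmul] at this
  change k * s.card ≤ _ at this
  rwa [hcard] at this

/-- The polynomial `G(f, Y)`, restricted to the monomials in `T`. -/
noncomputable def partialPoly (G : MvPolynomial (Fin 2) ℂ) (T : Finset (Fin 2 →₀ ℕ))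
    (f : MvPolynomial (Fin 3) ℂ) : Polynomial (MvPolynomial (Fin 3) ℂ) :=
  ∑ m ∈ T, Polynomial.C (C (coeff m G) * f ^ m 0) * Polynomial.X ^ m 1

lemma partialPoly_deriv (G : MvPolynomial (Fin 2) ℂ) (T : Finset (Fin 2 →₀ ℕ))
    (f g : MvPolynomial (Fin 3) ℂ) (k : ℕ) :
    (Polynomial.derivative^[k] (partialPoly G T f)).eval g =
      ∑ m ∈ T, C (coeff m G * ((m 1).descFactorial k : ℂ)) * (f ^ m 0 * g ^ (m 1 - k)) := by
  rw [partialPoly, Polynomial.iterate_derivative_sum, Polynomial.eval_finsetSum]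
  refine Finset.sum_congr rfl fun m _ => ?_
  rw [Polynomial.iterate_derivative_C_mul, Polynomial.iterate_derivative_X_pow_eq_natCast_mul]
  simp
  ring

lemma partialPoly_eval (G : MvPolynomial (Fin 2) ℂ) (f g : MvPolynomial (Fin 3) ℂ) :
    (partialPoly G G.support f).eval g = aeval ![f, g] G := by
  rw [partialPoly, Polynomial.eval_finsetSum, aeval_def, eval₂_eq']
  refine Finset.sum_congr rfl fun m _ => ?_
  simp [Fin.prod_univ_two, algebraMap_eq]
  ring

lemma partialPoly_coeff (G : MvPolynomial (Fin 2) ℂ) (T : Finset (Fin 2 →₀ ℕ))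
    (f : MvPolynomial (Fin 3) ℂ) (i : ℕ) :
    (partialPoly G T f).coeff i = ∑ m ∈ T, if i = m 1 then C (coeff m G) * f ^ m 0 else 0 := by
  rw [partialPoly, Polynomial.finsetSum_coeff]
  refine Finset.sum_congr rfl fun m _ => ?_
  rw [Polynomial.coeff_C_mul_X_pow]

/-- A version of the Shestakov-Umirbaev inequality, following the proof of Venereau. -/
lemma shestakov_umirbaev (f g : MvPolynomial (Fin 3) ℂ) (hf : 0 < f.totalDegree)
    (hg : 0 < g.totalDegree) (a b : Fin 3) (hD : jacD f a b g ≠ 0)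
    (G : MvPolynomial (Fin 2) ℂ) (hG : G ≠ 0) (p : ℕ) (hp : 0 < p)
    (hmod : ∀ i j i' j' : ℕ, i * f.totalDegree + j * g.totalDegree =
      i' * f.totalDegree + j' * g.totalDegree → j % p = j' % p) :
    ∃ k u v : ℕ, u * f.totalDegree + v * g.totalDegree + 2 * k ≤
        k * (f.totalDegree + g.totalDegree) + (aeval ![f, g] G).totalDegree ∧
      k * p ≤ v ∧
      (k = 0 → (aeval ![f, g] G).totalDegree = u * f.totalDegree + v * g.totalDegree) := by
  classical
  set df := f.totalDegree with hdf
  set dg := g.totalDegree with hdg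
  have hf0 : f ≠ 0 := by rintro rfl; simp at hdf; omega
  have hg0 : g ≠ 0 := by rintro rfl; simp at hdg; omega
  set fb := homogeneousComponent df f with hfb
  set gb := homogeneousComponent dg g with hgb
  have tf : IsTopForm df f fb := isTop_self f
  have tg : IsTopForm dg g gb := isTop_self g
  have fb0 : fb ≠ 0 := top_ne_zero hf0
  have gb0 : gb ≠ 0 := top_ne_zero hg0
  set wt : (Fin 2 →₀ ℕ) → ℕ := fun m => m 0 * df + m 1 * dg with hwt
  obtain ⟨m0, hm0, hmax⟩ := Finset.exists_max_image G.support wt (by simpa using hG)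
  set W := wt m0 with hW
  set T := G.support.filter (fun m => wt m = W) with hT
  have hinj : ∀ m ∈ T, ∀ m' ∈ T, m 1 = m' 1 → m = m' := by
    intro m hm m' hm' h1
    have e : wt m = wt m' := (Finset.mem_filter.1 hm).2.trans (Finset.mem_filter.1 hm').2.symm
    simp only [hwt, h1] at e
    have e0 : m 0 = m' 0 := Nat.eq_of_mul_eq_mul_right hf (by omega)
    ext i
    fin_cases i
    · exact e0
    · exact h1
  set R := partialPoly G G.support f with hR
  set Rb := partialPoly G T fb with hRb
  have hRb0 : Rb ≠ 0 := by
    intro h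
    have h1 : Rb.coeff (m0 1) = 0 := by rw [h]; simp
    have hm0T : m0 ∈ T := by simp [hT, hW, mem_support_iff.1 hm0]
    rw [hRb, partialPoly_coeff, Finset.sum_eq_single_of_mem m0 hm0T, if_pos rfl] at h1
    · have : C (coeff m0 G) ≠ (0 : MvPolynomial (Fin 3) ℂ) := by
        simpa using mem_support_iff.1 hm0
      exact mul_ne_zero this (pow_ne_zero _ fb0) h1
    · intro m hm hne
      rw [if_neg]
      intro h2
      exact hne (hinj m hm m0 hm0T h2.symm)
  have hsupp : ∀ i, Rb.coeff i ≠ 0 → ∃ m ∈ T, m 1 = i := by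
    intro i hi
    rw [hRb, partialPoly_coeff] at hi
    obtain ⟨m, hm, hne⟩ := Finset.exists_ne_zero_of_sum_ne_zero hi
    refine ⟨m, hm, ?_⟩
    by_contra h
    exact hne (if_neg (fun h' => h h'.symm))
  obtain ⟨mt, hmt, hmtd⟩ := hsupp Rb.natDegree (by
    rw [Polynomial.coeff_natDegree]; simpa using hRb0)
  have hmtW : wt mt = W := (Finset.mem_filter.1 hmt).2
  set k := Rb.rootMultiplicity gb with hk
  have hkp : k * p ≤ mt 1 := by
    rw [hmtd]
    refine mult_bound hRb0 p hp (fun i hi => ?_) gb gb0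
    obtain ⟨m, hm, rfl⟩ := hsupp i hi
    rw [← hmtd]
    refine hmod (m 0) _ (mt 0) _ ?_
    exact (Finset.mem_filter.1 hm).2.trans hmtW.symm
  have hkm : k ≤ mt 1 := le_trans (Nat.le_mul_of_pos_right k hp) hkp
  -- the top form of the `k`-th derivative does not vanish
  have hne : (Polynomial.derivative^[k] Rb).eval gb ≠ 0 := by
    intro h
    have : k < Rb.rootMultiplicity gb := by
      rw [Polynomial.lt_rootMultiplicity_iff_isRoot_iterate_derivative hRb0]
      intro m hm
      rcases hm.lt_or_eq with h1 | h1
      · exact Polynomial.isRoot_iterate_derivative_of_lt_rootMultiplicity h1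
      · rw [h1]; exact h
    omega
  obtain ⟨N, hN⟩ : ∃ N, N + k * dg = W := by
    refine ⟨W - k * dg, Nat.sub_add_cancel ?_⟩
    rw [← hmtW]
    exact (Nat.mul_le_mul_right dg hkm).trans (Nat.le_add_left _ _)
  have htop : IsTopForm N ((Polynomial.derivative^[k] R).eval g)
      ((Polynomial.derivative^[k] Rb).eval gb) := by
    have term : ∀ m : Fin 2 →₀ ℕ, IsTopForm (m 0 * df + (m 1 - k) * dg)
        (C (coeff m G * ((m 1).descFactorial k : ℂ)) * (f ^ m 0 * g ^ (m 1 - k)))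
        (C (coeff m G * ((m 1).descFactorial k : ℂ)) * (fb ^ m 0 * gb ^ (m 1 - k))) := by
      intro m
      have := (isTop_C (coeff m G * ((m 1).descFactorial k : ℂ))).mul
        ((tf.pow (m 0)).mul (tg.pow (m 1 - k)))
      rwa [zero_add] at this
    have hdeg : ∀ m : Fin 2 →₀ ℕ, k ≤ m 1 → m 0 * df + (m 1 - k) * dg + k * dg = wt m := by
      intro m hm
      simp only [hwt]
      rw [add_assoc, ← add_mul, Nat.sub_add_cancel hm]
    rw [hR, hRb, partialPoly_deriv, partialPoly_deriv]
    constructor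
    · refine IsHomogeneous.sum _ _ _ fun m hm => ?_
      by_cases hkm : k ≤ m 1
      · have := hdeg m hkm
        have h2 : wt m = W := (Finset.mem_filter.1 hm).2
        have h3 : m 0 * df + (m 1 - k) * dg = N := by omega
        rw [← h3]
        exact (term m).1
      · rw [Nat.descFactorial_eq_zero_iff_lt.2 (by omega)]
        simpa using isHomogeneous_zero _ _ _
    · rw [hT, Finset.sum_filter, ← Finset.sum_sub_distrib]
      refine DegLt.sum _ _ fun m hm => ?_
      by_cases hkm : k ≤ m 1
      · have h1 := hdeg m hkm
        have h2 : wt m ≤ W := hmax m hm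
        split_ifs with h3
        · have h4 : m 0 * df + (m 1 - k) * dg = N := by omega
          rw [← h4]
          exact (term m).2
        · rw [sub_zero]
          exact (term m).degLt.mono (by omega)
      · rw [Nat.descFactorial_eq_zero_iff_lt.2 (by omega)]
        simpa using DegLt.zero _
  obtain ⟨hk0, hkdeg⟩ := htop.totalDegree hne
  have hcoef : ∀ i, jacD f a b (R.coeff i) = 0 := by
    intro i
    rw [hR, partialPoly_coeff, map_sum]
    refine Finset.sum_eq_zero fun m _ => ?_
    split_ifs
    · rw [← algebraMap_eq, Derivation.leibniz, Derivation.leibniz_pow, jacD_self,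
        Derivation.map_algebraMap]
      simp
    · simp
  obtain ⟨-, hpar⟩ := parachute f g hf a b hD k R hcoef hk0
  rw [hkdeg, hR, partialPoly_eval, ← hdf] at hpar
  refine ⟨k, mt 0, mt 1, ?_, hkp, ?_⟩
  · change wt mt + _ ≤ _
    rw [hmtW, ← hN, mul_add]
    omega
  · intro hkz
    change _ = wt mt
    rw [hmtW, ← hN, ← hkdeg, hkz]
    simp [hR, partialPoly_eval]

lemma jac_ne_zero (F : MvPolynomial (Fin 3) ℂ ≃ₐ[ℂ] MvPolynomial (Fin 3) ℂ) (i j : Fin 3)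
    (hij : i ≠ j) : ∃ a b, jacD (F (X i)) a b (F (X j)) ≠ 0 := by
  by_contra! hcon
  -- chain rule
  have chain : ∀ l h, F (pderiv l h) = ∑ a, F (pderiv l (F.symm (X a))) * pderiv a (F h) := by
    intro l h
    let E : Derivation ℂ (MvPolynomial (Fin 3) ℂ) (MvPolynomial (Fin 3) ℂ) :=
      Derivation.mk' (F.toLinearMap ∘ₗ (pderiv l).toLinearMap ∘ₗ F.symm.toLinearMap) (by
        intro u v
        simp [Derivation.leibniz])
    have hEa : ∀ w, E w = F (pderiv l (F.symm w)) := fun _ => rfl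
    have hE : E = ∑ a, F (pderiv l (F.symm (X a))) • pderiv a := by
      apply derivation_ext
      intro c
      have : ∀ D : Fin 3 → Derivation ℂ (MvPolynomial (Fin 3) ℂ) (MvPolynomial (Fin 3) ℂ),
          (∑ a, D a) (X c) = ∑ a, D a (X c) := by
        intro D; simp [Fin.sum_univ_three]
      rw [this, hEa]
      simp [pderiv_X, Pi.single_apply]
    have h1 := congrArg (fun D => D (F h)) hE
    simp only [Fin.sum_univ_three] at h1 ⊢
    rw [hEa, AlgEquiv.symm_apply_apply] at h1
    simpa using h1
  have e1 := chain i (X i)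
  have e2 := chain j (X j)
  have e3 := chain i (X j)
  have e4 := chain j (X i)
  rw [pderiv_X_self, map_one] at e1 e2
  rw [pderiv_X_of_ne hij.symm, map_zero] at e3
  rw [pderiv_X_of_ne hij, map_zero] at e4
  have h01 := hcon 0 1
  have h02 := hcon 0 2
  have h12 := hcon 1 2
  rw [jacD_apply] at h01 h02 h12
  simp only [Fin.sum_univ_three] at e1 e2 e3 e4
  generalize pderiv 0 (F (X i)) = x0 at *
  generalize pderiv 1 (F (X i)) = x1 at *
  generalize pderiv 2 (F (X i)) = x2 at *
  generalize pderiv 0 (F (X j)) = y0 at *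
  generalize pderiv 1 (F (X j)) = y1 at *
  generalize pderiv 2 (F (X j)) = y2 at *
  generalize F (pderiv i (F.symm (X 0))) = u0 at *
  generalize F (pderiv i (F.symm (X 1))) = u1 at *
  generalize F (pderiv i (F.symm (X 2))) = u2 at *
  generalize F (pderiv j (F.symm (X 0))) = v0 at *
  generalize F (pderiv j (F.symm (X 1))) = v1 at *
  generalize F (pderiv j (F.symm (X 2))) = v2 at *
  have key : (u0 * x0 + u1 * x1 + u2 * x2) * (v0 * y0 + v1 * y1 + v2 * y2) -
      (u0 * y0 + u1 * y1 + u2 * y2) * (v0 * x0 + v1 * x1 + v2 * x2) = 0 := by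
    linear_combination (u0 * v1 - u1 * v0) * h01 + (u0 * v2 - u2 * v0) * h02 +
      (u1 * v2 - u2 * v1) * h12
  rw [← e1, ← e2, ← e3, ← e4] at key
  simp at key

/-- Consequence of an elementary reduction of `F_l` using `F_i`, `F_j`. -/
lemma reduction_ineq (F : MvPolynomial (Fin 3) ℂ ≃ₐ[ℂ] MvPolynomial (Fin 3) ℂ) (l i j : Fin 3)
    (hij : i ≠ j) (h : MvPolynomial (Fin 3) ℂ) (hh : h ∈ Set.range (aeval ![F (X i), F (X j)] :
      MvPolynomial (Fin 2) ℂ →ₐ[ℂ] MvPolynomial (Fin 3) ℂ))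
    (hlt : (F (X l) - h).totalDegree < (F (X l)).totalDegree) (dl di dj : ℕ)
    (hl : (F (X l)).totalDegree = dl)
    (hi : (F (X i)).totalDegree = di) (hj : (F (X j)).totalDegree = dj)
    (hi0 : 0 < di) (hj0 : 0 < dj) (p : ℕ) (hp : 0 < p)
    (hmod : ∀ a b a' b' : ℕ, a * di + b * dj = a' * di + b' * dj → b % p = b' % p) :
    ∃ k u v : ℕ, u * di + v * dj + 2 * k ≤ k * (di + dj) + dl ∧ k * p ≤ v ∧
      (k = 0 → dl = u * di + v * dj) := by
  obtain ⟨G, rfl⟩ := hh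
  have hdeg : (aeval ![F (X i), F (X j)] G).totalDegree = dl := by
    have e : aeval ![F (X i), F (X j)] G =
      F (X l) - (F (X l) - aeval ![F (X i), F (X j)] G) := by ring
    rw [e, sub_eq_add_neg, totalDegree_add_eq_left_of_totalDegree_lt, hl]
    rwa [totalDegree_neg]
  have hG : G ≠ 0 := by
    rintro rfl
    simp at hlt
  obtain ⟨a, b, hD⟩ := jac_ne_zero F i j hij
  subst hi hj
  have := shestakov_umirbaev _ _ hi0 hj0 a b hD G hG p hp hmod
  rwa [hdeg] at this

lemma mod_three (d : ℕ) (hd : ¬ 3 ∣ d) (a b a' b' : ℕ) (h : a * 3 + b * d = a' * 3 + b' * d) :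
    b % 3 = b' % 3 := by
  have h1 : b * d ≡ b' * d [MOD 3] := by
    unfold Nat.ModEq; omega
  exact Nat.ModEq.cancel_right_of_coprime ((Nat.Prime.coprime_iff_not_dvd Nat.prime_three).2 hd) h1

lemma aeval_swap (A B : MvPolynomial (Fin 3) ℂ) (g : MvPolynomial (Fin 2) ℂ) :
    aeval ![A, B] g ∈ Set.range (aeval ![B, A] :
      MvPolynomial (Fin 2) ℂ →ₐ[ℂ] MvPolynomial (Fin 3) ℂ) := by
  refine ⟨rename (Equiv.swap 0 1) g, ?_⟩
  rw [aeval_rename]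
  congr 2
  ext1 i
  fin_cases i <;> simp

lemma perm_cases : ∀ l i j : Fin 3, l ≠ i → l ≠ j → i ≠ j →
    (l = 0 ∧ i = 1 ∧ j = 2) ∨ (l = 0 ∧ i = 2 ∧ j = 1) ∨ (l = 1 ∧ i = 0 ∧ j = 2) ∨
    (l = 1 ∧ i = 2 ∧ j = 0) ∨ (l = 2 ∧ i = 0 ∧ j = 1) ∨ (l = 2 ∧ i = 1 ∧ j = 0) := by
  decide

lemma numeric_bound (d2 d3 : ℕ) (h23 : d2 ≤ d3)
    (hdvd : ¬ 3 ∣ d2) (hmem : ¬ ∃ a b : ℕ, d3 = 3 * a + b * d2) : d3 + 3 ≤ 2 * d2 := by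
  have hx := Nat.div_add_mod d2 3
  have hy := Nat.div_add_mod d3 3
  have hr : d2 % 3 = 1 ∨ d2 % 3 = 2 := by omega
  have ht : d3 % 3 = 0 ∨ d3 % 3 = 1 ∨ d3 % 3 = 2 := by omega
  generalize d2 / 3 = x at *
  generalize d3 / 3 = y at *
  by_contra hcon
  rcases hr with hr | hr <;> rcases ht with ht | ht | ht <;> rw [hr] at hx <;> rw [ht] at hy
  · exact hmem ⟨y, 0, by omega⟩
  · exact hmem ⟨y - x, 1, by omega⟩
  · exact hmem ⟨y - 2 * x, 2, by omega⟩
  · exact hmem ⟨y, 0, by omega⟩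
  · exact hmem ⟨y - 2 * x - 1, 2, by omega⟩
  · exact hmem ⟨y - x, 1, by omega⟩

/-- Suppose `3 ≤ d2 ≤ d3`, `3 ∤ d2` and `d3 ∉ 3ℕ + d2ℕ`. If `F = (F₁, F₂, F₃)` is a polynomial
automorphism of `ℂ³` with `mdeg F = (3, d2, d3)`, then `F` admits no elementary reduction: there
is no permutation `σ` of `{1,2,3}` and `g ∈ ℂ[x,y]` with
`deg (F_{σ(1)} - g(F_{σ(2)}, F_{σ(3)})) < deg F_{σ(1)}`. -/
theorem no_elementary_reduction (d2 d3 : ℕ) (h2 : 3 ≤ d2) (h23 : d2 ≤ d3)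
    (hdvd : ¬ 3 ∣ d2) (hmem : ¬ ∃ a b : ℕ, d3 = 3 * a + b * d2)
    (F : MvPolynomial (Fin 3) ℂ ≃ₐ[ℂ] MvPolynomial (Fin 3) ℂ)
    (hF1 : (F (X 0)).totalDegree = 3) (hF2 : (F (X 1)).totalDegree = d2)
    (hF3 : (F (X 2)).totalDegree = d3) :
    ¬ ∃ (σ : Equiv.Perm (Fin 3)) (g : MvPolynomial (Fin 2) ℂ),
      (F (X (σ 0)) - aeval ![F (X (σ 1)), F (X (σ 2))] g).totalDegree <
        (F (X (σ 0))).totalDegree := by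
  rintro ⟨σ, g, hlt⟩
  have n1 : ¬ 3 ∣ d3 := fun ⟨a, h⟩ => hmem ⟨a, 0, by omega⟩
  have n2 : ∀ b, d3 ≠ b * d2 := fun b h => hmem ⟨0, b, by omega⟩
  have n5 : d3 + 3 ≤ 2 * d2 := numeric_bound d2 d3 h23 hdvd hmem
  have n3 : d3 < 2 * d2 := by omega
  have n4 : d2 < d3 := lt_of_le_of_ne h23 (fun h => n2 1 (by omega))
  -- reductions of `F₁`
  have case1 : ∀ h ∈ Set.range (aeval ![F (X 1), F (X 2)] :
      MvPolynomial (Fin 2) ℂ →ₐ[ℂ] MvPolynomial (Fin 3) ℂ),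
      ¬ (F (X 0) - h).totalDegree < (F (X 0)).totalDegree := by
    intro h hh hlt
    have hgpos : 0 < Nat.gcd d2 d3 := Nat.gcd_pos_of_pos_left _ (by omega)
    have hpg : d2 / Nat.gcd d2 d3 * Nat.gcd d2 d3 = d2 := Nat.div_mul_cancel (Nat.gcd_dvd_left _ _)
    obtain ⟨s, hs⟩ := Nat.gcd_dvd_right d2 d3
    have hp : 0 < d2 / Nat.gcd d2 d3 :=
      Nat.div_pos (Nat.le_of_dvd (by omega) (Nat.gcd_dvd_left _ _)) hgpos
    obtain ⟨k, u, v, e1, e2, e3⟩ := reduction_ineq F 0 1 2 (by decide) h hh hlt 3 d2 d3 hF1 hF2 hF3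
      (by omega) (by omega) (d2 / Nat.gcd d2 d3) hp (by
        intro a b a' b' he
        refine Nat.ModEq.cancel_right_div_gcd (m := d2) (c := d3) (by omega) ?_
        have e : (a * d2 + b * d3) % d2 = (a' * d2 + b' * d3) % d2 := by rw [he]
        simpa [Nat.ModEq] using e)
    generalize d2 / Nat.gcd d2 d3 = p at *
    generalize Nat.gcd d2 d3 = m at *
    rcases Nat.eq_zero_or_pos k with hk | hk
    · have e4 := e3 hk
      rcases Nat.eq_zero_or_pos u with hu | hu
      · rcases Nat.eq_zero_or_pos v with hv | hv
        · subst hu hv; omega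
        · nlinarith
      · have : 4 ≤ d2 := by omega
        nlinarith
    · have hp1 : p ≠ 1 := by
        rintro rfl
        apply n2 s
        rw [hs, ← hpg]; ring
      have hp2 : p ≠ 2 := by
        rintro rfl
        have s1 : 2 < s := by
          by_contra hc
          have : m * s ≤ m * 2 := Nat.mul_le_mul_left m (by omega)
          omega
        have s2 : s < 4 := by
          by_contra hc
          have : m * 4 ≤ m * s := Nat.mul_le_mul_left m (by omega)
          omega
        have : s = 3 := by omega
        exact n1 ⟨m, by rw [hs, this]; ring⟩
      have hv : k * 3 ≤ v := le_trans (Nat.mul_le_mul_left k (by omega)) e2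
      have a1 : k * 3 * d3 ≤ v * d3 := Nat.mul_le_mul_right d3 hv
      have a2 : k * d2 ≤ k * d3 := Nat.mul_le_mul_left k h23
      have a3 : 1 * d3 ≤ k * d3 := Nat.mul_le_mul_right d3 hk
      nlinarith
  -- reductions of `F₂`
  have case2 : ∀ h ∈ Set.range (aeval ![F (X 0), F (X 2)] :
      MvPolynomial (Fin 2) ℂ →ₐ[ℂ] MvPolynomial (Fin 3) ℂ),
      ¬ (F (X 1) - h).totalDegree < (F (X 1)).totalDegree := by
    intro h hh hlt
    obtain ⟨k, u, v, e1, e2, e3⟩ := reduction_ineq F 1 0 2 (by decide) h hh hlt d2 3 d3 hF2 hF1 hF3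
      (by omega) (by omega) 3 (by omega) (mod_three d3 n1)
    rcases Nat.eq_zero_or_pos k with hk | hk
    · have e4 := e3 hk
      rcases Nat.eq_zero_or_pos v with hv | hv
      · subst hv; omega
      · nlinarith
    · have a1 : k * 3 * d3 ≤ v * d3 := Nat.mul_le_mul_right d3 e2
      have a3 : 1 * d3 ≤ k * d3 := Nat.mul_le_mul_right d3 hk
      have a4 : k * 4 ≤ k * d3 := Nat.mul_le_mul_left k (by omega)
      nlinarith
  -- reductions of `F₃`
  have case3 : ∀ h ∈ Set.range (aeval ![F (X 0), F (X 1)] :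
      MvPolynomial (Fin 2) ℂ →ₐ[ℂ] MvPolynomial (Fin 3) ℂ),
      ¬ (F (X 2) - h).totalDegree < (F (X 2)).totalDegree := by
    intro h hh hlt
    obtain ⟨k, u, v, e1, e2, e3⟩ := reduction_ineq F 2 0 1 (by decide) h hh hlt d3 3 d2 hF3 hF1 hF2
      (by omega) (by omega) 3 (by omega) (mod_three d2 hdvd)
    rcases Nat.eq_zero_or_pos k with hk | hk
    · exact hmem ⟨u, v, by rw [e3 hk]; ring⟩
    · have a1 : k * 3 * d2 ≤ v * d2 := Nat.mul_le_mul_right d2 e2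
      obtain ⟨j, rfl⟩ : ∃ j, k = j + 1 := ⟨k - 1, by omega⟩
      nlinarith [Nat.mul_le_mul_left j h2]
  have d01 : σ 0 ≠ σ 1 := σ.injective.ne (by decide)
  have d02 : σ 0 ≠ σ 2 := σ.injective.ne (by decide)
  have d12 : σ 1 ≠ σ 2 := σ.injective.ne (by decide)
  rcases perm_cases _ _ _ d01 d02 d12 with h | h | h | h | h | h <;>
    rw [h.1, h.2.1, h.2.2] at hlt
  · exact case1 _ ⟨g, rfl⟩ hlt
  · exact case1 _ (aeval_swap _ _ g) hlt
  · exact case2 _ ⟨g, rfl⟩ hlt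
  · exact case2 _ (aeval_swap _ _ g) hlt
  · exact case3 _ ⟨g, rfl⟩ hlt
  · exact case3 _ (aeval_swap _ _ g) hlt
end
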